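/- arXiv:math/0702444 — 2 statements merged into one kernel-verified Lean document; each statement's English description precedes it below -/
import Mathlib

section
/- Let K be a field of characteristic zero and A = ⊕_{i=0}^{c} A_i a graded Artinian K-algebra with A_c ≠ 0. Then the following are equivalent: (i) A has the SLP; (ii) there exists a linear form z ∈ A_1 such that every central simple module U_i of (A, z) (for i = 1, ..., s) has the SLP, and for each i the Hilbert function of Ũ_i = U_i ⊗_K K[t]/(t^{f_i}) is symmetric with reflecting degree equal to c/2. -/
set_option maxHeartbeats 1000000
set_option synthInstance.maxHeartbeats 400000

open TensorProduct

section LefschetzPrelude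

variable (K : Type) [Field K]

/-- `𝒜` makes `A` into a graded Artinian `K`-algebra (with possibly non-standard
grading): `A` is the internal direct sum of the `𝒜 i`, the grading is
multiplicative, `A₀ = K·1` and `A` is finite dimensional over `K`. -/
def IsGradedArtinAlg {A : Type} [CommRing A] [Algebra K A]
    (𝒜 : ℕ → Submodule K A) : Prop :=
  DirectSum.IsInternal 𝒜 ∧
  (1 : A) ∈ 𝒜 0 ∧
  (∀ i j : ℕ, ∀ x ∈ 𝒜 i, ∀ y ∈ 𝒜 j, x * y ∈ 𝒜 (i + j)) ∧
  𝒜 0 = Submodule.span K {(1 : A)} ∧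
  FiniteDimensional K A

/-- `c` is the top degree of the grading `𝒜`. -/
def GradedTop {A : Type} [CommRing A] [Algebra K A]
    (𝒜 : ℕ → Submodule K A) (c : ℕ) : Prop :=
  𝒜 c ≠ ⊥ ∧ ∀ i : ℕ, c < i → 𝒜 i = ⊥

/-- `ℳ` makes the `A`-module `V` into a finite graded module over the graded
algebra `(A, 𝒜)`. -/
def IsGradedMod {A V : Type} [CommRing A] [Algebra K A] [AddCommGroup V]
    [Module K V] [Module A V] [IsScalarTower K A V]
    (𝒜 : ℕ → Submodule K A) (ℳ : ℤ → Submodule K V) : Prop :=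
  DirectSum.IsInternal ℳ ∧
  (∀ (i : ℕ) (j : ℤ), ∀ a ∈ 𝒜 i, ∀ v ∈ ℳ j, a • v ∈ ℳ (j + i)) ∧
  FiniteDimensional K V

/-- The graded pieces of `ℳ` are supported exactly between degrees `a` and `b`. -/
def GradedBetween {V : Type} [AddCommGroup V] [Module K V]
    (ℳ : ℤ → Submodule K V) (a b : ℤ) : Prop :=
  a ≤ b ∧ ℳ a ≠ ⊥ ∧ ℳ b ≠ ⊥ ∧ ∀ i : ℤ, i < a ∨ b < i → ℳ i = ⊥

/-- Multiplication by `g : A` on the `A`-module `V`, as a `K`-linear endomorphism. -/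
noncomputable def mulMap {A : Type} (V : Type) [CommRing A] [Algebra K A] [AddCommGroup V]
    [Module K V] [Module A V] [IsScalarTower K A V] (g : A) : Module.End K V :=
  (LinearMap.lsmul A V g).restrictScalars K

/-- The endomorphism `f` of the graded vector space `ℳ` (supported between
degrees `a` and `b`) is a weak Lefschetz operator: each `f : ℳ i → ℳ (i+1)` is
injective or surjective. -/
def IsWLEndo {V : Type} [AddCommGroup V] [Module K V]
    (ℳ : ℤ → Submodule K V) (a b : ℤ) (f : Module.End K V) : Prop :=
  ∀ i : ℤ, a ≤ i → i + 1 ≤ b →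
    ((∀ v ∈ ℳ i, f v = 0 → v = 0) ∨ (∀ w ∈ ℳ (i + 1), ∃ v ∈ ℳ i, f v = w))

/-- The endomorphism `f` of the graded vector space `ℳ` (supported between
degrees `a` and `b`) is a strong Lefschetz operator:
`f^(b-a-2i) : ℳ (a+i) → ℳ (b-i)` is bijective for all `0 ≤ 2i ≤ b-a`. -/
def IsSLEndo {V : Type} [AddCommGroup V] [Module K V]
    (ℳ : ℤ → Submodule K V) (a b : ℤ) (f : Module.End K V) : Prop :=
  ∀ i : ℕ, 2 * (i : ℤ) ≤ b - a →
    (∀ v ∈ ℳ (a + i), (f ^ (b - a - 2 * i).toNat) v = 0 → v = 0) ∧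
    (∀ w ∈ ℳ (b - i), ∃ v ∈ ℳ (a + i), (f ^ (b - a - 2 * i).toNat) v = w)

/-- `g ∈ A₁` is a weak Lefschetz element for the graded module `(V, ℳ)`. -/
def IsWLElem {A V : Type} [CommRing A] [Algebra K A] [AddCommGroup V]
    [Module K V] [Module A V] [IsScalarTower K A V]
    (𝒜 : ℕ → Submodule K A) (ℳ : ℤ → Submodule K V) (a b : ℤ) (g : A) : Prop :=
  g ∈ 𝒜 1 ∧ IsWLEndo K ℳ a b (mulMap K V g)

/-- `g ∈ A₁` is a strong Lefschetz element for the graded module `(V, ℳ)`. -/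
def IsSLElem {A V : Type} [CommRing A] [Algebra K A] [AddCommGroup V]
    [Module K V] [Module A V] [IsScalarTower K A V]
    (𝒜 : ℕ → Submodule K A) (ℳ : ℤ → Submodule K V) (a b : ℤ) (g : A) : Prop :=
  g ∈ 𝒜 1 ∧ IsSLEndo K ℳ a b (mulMap K V g)

/-- The Hilbert function of the graded vector space `ℳ`. -/
noncomputable def hilb {V : Type} [AddCommGroup V] [Module K V]
    (ℳ : ℤ → Submodule K V) (i : ℤ) : ℕ :=
  Module.finrank K (ℳ i)

/-- The Hilbert function of `ℳ`, supported between `a` and `b`, is symmetric. -/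
def SymHilb {V : Type} [AddCommGroup V] [Module K V]
    (ℳ : ℤ → Submodule K V) (a b : ℤ) : Prop :=
  ∀ i : ℤ, hilb K ℳ (a + i) = hilb K ℳ (b - i)

/-- The Hilbert function of `ℳ`, supported between `a` and `b`, is unimodal. -/
def UnimodalHilb {V : Type} [AddCommGroup V] [Module K V]
    (ℳ : ℤ → Submodule K V) (a b : ℤ) : Prop :=
  ∃ m : ℤ, a ≤ m ∧ m ≤ b ∧
    (∀ i j : ℤ, a ≤ i → i ≤ j → j ≤ m → hilb K ℳ i ≤ hilb K ℳ j) ∧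
    (∀ i j : ℤ, m ≤ i → i ≤ j → j ≤ b → hilb K ℳ j ≤ hilb K ℳ i)

/-- The Sperner number of `ℳ` (supported between `a` and `b`). -/
noncomputable def sperner {V : Type} [AddCommGroup V] [Module K V]
    (ℳ : ℤ → Submodule K V) (a b : ℤ) : ℕ :=
  (Finset.Icc a b).sup fun i => hilb K ℳ i

/-- The CoSperner number of `ℳ` (supported between `a` and `b`). -/
noncomputable def coSperner {V : Type} [AddCommGroup V] [Module K V]
    (ℳ : ℤ → Submodule K V) (a b : ℤ) : ℕ :=
  ∑ i ∈ Finset.Icc a (b - 1), min (hilb K ℳ i) (hilb K ℳ (i + 1))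

/-- `SP_k(V) = Σ_{i=a}^{b} max (dim V_i - dim V_{i-k}) 0` (via truncated
subtraction on `ℕ`). -/
noncomputable def spernerVec {V : Type} [AddCommGroup V] [Module K V]
    (ℳ : ℤ → Submodule K V) (a b : ℤ) (k : ℕ) : ℕ :=
  ∑ i ∈ Finset.Icc a b, (hilb K ℳ i - hilb K ℳ (i - (k : ℤ)))

/-- `d` is the multiset of Jordan block sizes of the (nilpotent) endomorphism `f`:
all entries are positive and `dim ker f^k = Σ_{n ∈ d} min n k` for every `k`. -/
def IsJordanType {V : Type} [AddCommGroup V] [Module K V]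
    (f : Module.End K V) (d : Multiset ℕ) : Prop :=
  (∀ n ∈ d, 0 < n) ∧
  ∀ k : ℕ, Module.finrank K (LinearMap.ker (f ^ k)) = (d.map fun n => min n k).sum

/-- `g ∈ A₁` is a weak Lefschetz element of the graded algebra `(A, 𝒜)` with top
degree `c`. -/
def IsAlgWLElem {A : Type} [CommRing A] [Algebra K A]
    (𝒜 : ℕ → Submodule K A) (c : ℕ) (g : A) : Prop :=
  g ∈ 𝒜 1 ∧ ∀ i : ℕ, i + 1 ≤ c →
    ((∀ v ∈ 𝒜 i, g * v = 0 → v = 0) ∨ (∀ w ∈ 𝒜 (i + 1), ∃ v ∈ 𝒜 i, g * v = w))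

/-- `g ∈ A₁` is a strong Lefschetz element of the graded algebra `(A, 𝒜)` with top
degree `c`: `×g^(c-2i) : A_i → A_{c-i}` is bijective for `0 ≤ 2i ≤ c`. -/
def IsAlgSLElem {A : Type} [CommRing A] [Algebra K A]
    (𝒜 : ℕ → Submodule K A) (c : ℕ) (g : A) : Prop :=
  g ∈ 𝒜 1 ∧ ∀ i : ℕ, 2 * i ≤ c →
    (∀ v ∈ 𝒜 i, g ^ (c - 2 * i) * v = 0 → v = 0) ∧
    (∀ w ∈ 𝒜 (c - i), ∃ v ∈ 𝒜 i, g ^ (c - 2 * i) * v = w)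

/-- The graded algebra `(A, 𝒜)` has the weak Lefschetz property. -/
def AlgHasWLP {A : Type} [CommRing A] [Algebra K A] (𝒜 : ℕ → Submodule K A) : Prop :=
  ∃ c : ℕ, GradedTop K 𝒜 c ∧ ∃ g : A, IsAlgWLElem K 𝒜 c g

/-- The graded algebra `(A, 𝒜)` has the strong Lefschetz property. -/
def AlgHasSLP {A : Type} [CommRing A] [Algebra K A] (𝒜 : ℕ → Submodule K A) : Prop :=
  ∃ c : ℕ, GradedTop K 𝒜 c ∧ ∃ g : A, IsAlgSLElem K 𝒜 c g

/-- The graded pieces of the tensor product `V ⊗[K] W` of two graded vector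
spaces: `(ℳ ⊗ 𝒩)_k = Σ_{i+j=k} ℳ_i ⊗ 𝒩_j`. -/
noncomputable def tensorGrading {V W : Type} [AddCommGroup V] [Module K V]
    [AddCommGroup W] [Module K W] (ℳ : ℤ → Submodule K V) (𝒩 : ℤ → Submodule K W)
    (k : ℤ) : Submodule K (V ⊗[K] W) :=
  ⨆ i : ℤ, LinearMap.range (TensorProduct.map (ℳ i).subtype (𝒩 (k - i)).subtype)

/-- Reindex a `ℕ`-indexed grading by `ℤ`. -/
noncomputable def natToZ {V : Type} [AddCommGroup V] [Module K V]
    (ℒ : ℕ → Submodule K V) (i : ℤ) : Submodule K V :=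
  if 0 ≤ i then ℒ i.toNat else ⊥

/-- The truncated polynomial ring `K[t]/(t^α)`. -/
abbrev TruncPoly (α : ℕ) : Type :=
  Polynomial K ⧸ Ideal.span {(Polynomial.X : Polynomial K) ^ α}

/-- The image of `t` in `K[t]/(t^α)`. -/
noncomputable def tbar (α : ℕ) : TruncPoly K α :=
  Ideal.Quotient.mk _ Polynomial.X

/-- The standard grading of `K[t]/(t^α)` (with `deg t = 1`): the degree-`j` piece
is spanned by the class of `t^j` for `0 ≤ j < α`, and is zero otherwise. -/
noncomputable def truncGrading (α : ℕ) (j : ℤ) : Submodule K (TruncPoly K α) :=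
  if 0 ≤ j ∧ j < (α : ℤ) then Submodule.span K {tbar K α ^ j.toNat} else ⊥

end LefschetzPrelude

section CentralSimple

variable (K : Type) [Field K]

/-- The ideal `(0 :_A z^m) + zA` of `A`. -/
noncomputable def colonPlus {A : Type} [CommRing A] [Algebra K A] (z : A) (m : ℕ) : Ideal A :=
  LinearMap.ker (LinearMap.lsmul A A (z ^ m)) ⊔ Ideal.span {z}

/-- The subquotient `((0 :_A z^m) + zA) / ((0 :_A z^m') + zA)` of `A`, as an
`A`-module.  For `m = f_i`, `m' = f_{i+1}` consecutive distinct Jordan block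
sizes of `×z`, this is the `i`-th central simple module of `(A, z)`. -/
abbrev CSMod {A : Type} [CommRing A] [Algebra K A] (z : A) (m m' : ℕ) : Type :=
  ↥(colonPlus K z m) ⧸
    Submodule.comap (colonPlus K z m).subtype (colonPlus K z m')

/-- The degree-`d` graded piece of the central simple module `CSMod z m m'`:
the image of `((0 :_A z^m) + zA) ∩ A_d`. -/
noncomputable def csGrading {A : Type} [CommRing A] [Algebra K A]
    (𝒜 : ℕ → Submodule K A) (z : A) (m m' : ℕ) (d : ℕ) :
    Submodule K (CSMod K z m m') :=
  Submodule.map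
    ((Submodule.comap (colonPlus K z m).subtype (colonPlus K z m')).mkQ.restrictScalars K)
    (Submodule.comap ((colonPlus K z m).subtype.restrictScalars K) (𝒜 d))

/-- `f : Fin s → ℕ` enumerates, in strictly decreasing order, the distinct entries
of the multiset `d`. -/
def DistinctSizes (d : Multiset ℕ) {s : ℕ} (f : Fin s → ℕ) : Prop :=
  StrictAnti f ∧ ∀ n : ℕ, (∃ i, f i = n) ↔ n ∈ d

/-- The successor value `f_{i+1}`, with the convention `f_{s+1} = 0`. -/
def nextSize {s : ℕ} (f : Fin s → ℕ) (i : Fin s) : ℕ :=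
  if h : (i : ℕ) + 1 < s then f ⟨(i : ℕ) + 1, h⟩ else 0

/-- The graded vector space `ℒ` has a symmetric Hilbert function with
reflecting degree `c/2`, i.e. its support is an interval `[a, b]` with
`a + b = c` and `dim ℒ_{a+j} = dim ℒ_{b-j}` for all `j`. -/
def SymAround {V : Type} [AddCommGroup V] [Module K V]
    (ℒ : ℤ → Submodule K V) (c : ℤ) : Prop :=
  ∃ a b : ℤ, GradedBetween K ℒ a b ∧ a + b = c ∧ SymHilb K ℒ a b

/-- The graded `A`-module with pieces `ℒ` has the strong Lefschetz property:
some linear form `g ∈ A₁` is a strong Lefschetz element between the (exact)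
bounds of the support of `ℒ`. -/
def PiecesHasSLP {A V : Type} [CommRing A] [Algebra K A] [AddCommGroup V]
    [Module K V] [Module A V] [IsScalarTower K A V]
    (𝒜 : ℕ → Submodule K A) (ℒ : ℤ → Submodule K V) : Prop :=
  ∃ a b : ℤ, GradedBetween K ℒ a b ∧
    ∃ g ∈ 𝒜 1, IsSLEndo K ℒ a b (mulMap K V g)

/-- The graded vector space `ℒ` has a symmetric Hilbert function. -/
def SymHilbSome {V : Type} [AddCommGroup V] [Module K V]
    (ℒ : ℤ → Submodule K V) : Prop :=
  ∃ a b : ℤ, GradedBetween K ℒ a b ∧ SymHilb K ℒ a b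

/-- The graded algebra `(A, 𝒜)` (with graded maximal ideal `m = ⊕_{i≥1} A_i`)
is Gorenstein: the socle `0 :_A m` is one dimensional over `K`. -/
def IsGorenstein {A : Type} [CommRing A] [Algebra K A]
    (𝒜 : ℕ → Submodule K A) : Prop :=
  ∃ x : A, x ≠ 0 ∧ (∀ i : ℕ, 1 ≤ i → ∀ y ∈ 𝒜 i, x * y = 0) ∧
    ∀ x' : A, (∀ i : ℕ, 1 ≤ i → ∀ y ∈ 𝒜 i, x' * y = 0) → ∃ c : K, x' = c • x

end CentralSimple

/-- A curve in a vector space is polynomial if all its linear coordinates are. -/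
def PolyCurve (K : Type) [Field K] {W : Type} [AddCommGroup W] [Module K W] (γ : K → W) : Prop :=
  ∀ φ : W →ₗ[K] K, ∃ p : Polynomial K, ∀ τ, φ (γ τ) = p.eval τ

section PolyCurve

variable {K : Type} [Field K] {V W : Type} [AddCommGroup V] [Module K V]
  [AddCommGroup W] [Module K W]

lemma polyCurve_const (w : W) : PolyCurve K (fun _ => w) := fun φ =>
  ⟨Polynomial.C (φ w), fun τ => by simp⟩

lemma PolyCurve.add {γ δ : K → W} (hγ : PolyCurve K γ) (hδ : PolyCurve K δ) :
    PolyCurve K (fun τ => γ τ + δ τ) := fun φ => by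
  obtain ⟨p, hp⟩ := hγ φ
  obtain ⟨q, hq⟩ := hδ φ
  exact ⟨p + q, fun τ => by simp [hp, hq]⟩

lemma PolyCurve.sum {ι : Type*} (s : Finset ι) {γ : ι → K → W} (h : ∀ i ∈ s, PolyCurve K (γ i)) :
    PolyCurve K (fun τ => ∑ i ∈ s, γ i τ) := by
  classical
  induction s using Finset.induction_on with
  | empty => simpa using polyCurve_const (K := K) (0 : W)
  | insert a s ha ih =>
    simp only [Finset.sum_insert ha]
    exact (h a (by simp)).add (ih fun i hi => h i (by simp [hi]))

lemma PolyCurve.eval_smul {γ : K → W} (p : Polynomial K) (hγ : PolyCurve K γ) :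
    PolyCurve K (fun τ => p.eval τ • γ τ) := fun φ => by
  obtain ⟨q, hq⟩ := hγ φ
  exact ⟨p * q, fun τ => by simp [hq]⟩

lemma PolyCurve.apply [FiniteDimensional K V] {L : K → V →ₗ[K] W} {γ : K → V}
    (hL : ∀ v, PolyCurve K (fun τ => L τ v)) (hγ : PolyCurve K γ) :
    PolyCurve K (fun τ => L τ (γ τ)) := by
  let b := Module.finBasis K V
  choose p hp using fun i => hγ (b.coord i)
  have h : (fun τ => L τ (γ τ)) = fun τ => ∑ i, (p i).eval τ • L τ (b i) := by
    funext τ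
    conv_lhs => rw [← b.sum_repr (γ τ)]
    simp only [map_sum, map_smul]
    exact Finset.sum_congr rfl fun i _ => by rw [← hp i τ, Module.Basis.coord_apply]
  rw [h]
  exact PolyCurve.sum _ fun i _ => (hL _).eval_smul _

lemma polyCurve_pow_apply [FiniteDimensional K V] {L : K → Module.End K V}
    (hL : ∀ v, PolyCurve K (fun τ => L τ v)) (n : ℕ) (v : V) :
    PolyCurve K (fun τ => (L τ ^ n) v) := by
  induction n with
  | zero => simpa using polyCurve_const (K := K) v
  | succ n ih =>
    simp only [pow_succ', Module.End.mul_apply]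
    exact PolyCurve.apply hL ih

/-- Injectivity is a Zariski open condition in polynomial families of linear maps. -/
lemma finite_not_injective [FiniteDimensional K V] {F : K → V →ₗ[K] W}
    (hF : ∀ v, PolyCurve K (fun τ => F τ v)) {τ₀ : K} (h₀ : Function.Injective (F τ₀)) :
    {τ | ¬ Function.Injective (F τ)}.Finite := by
  obtain ⟨G, hG⟩ := (F τ₀).exists_leftInverse_of_injective (LinearMap.ker_eq_bot.2 h₀)
  let b := Module.finBasis K V
  choose p hp using fun i j => hF (b j) (b.coord i ∘ₗ G)
  let P : Matrix _ _ (Polynomial K) := Matrix.of p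
  have hdet : ∀ τ, P.det.eval τ = LinearMap.det (G ∘ₗ F τ) := by
    intro τ
    rw [← LinearMap.det_toMatrix b, ← Polynomial.coe_evalRingHom, RingHom.map_det]
    congr 1
    ext i j
    simp [P, LinearMap.toMatrix_apply, ← hp]
  have hP : P.det ≠ 0 := by
    intro h
    have := hdet τ₀
    rw [hG, h] at this
    simp at this
  classical
  refine (P.det.roots.toFinset.finite_toSet).subset fun τ hτ => ?_
  simp only [Finset.mem_coe, Multiset.mem_toFinset, Polynomial.mem_roots hP, Polynomial.IsRoot]
  by_contra hne
  apply hτ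
  rw [hdet] at hne
  have hb : Function.Injective (G ∘ₗ F τ) :=
    LinearMap.ker_eq_bot.1 (not_not.1 (LinearMap.det_eq_zero_iff_ker_ne_bot.not.1 hne))
  exact Function.Injective.of_comp (f := G) (by simpa using hb)

end PolyCurve

/-- Finitely many conditions that are nonempty and generic on lines hold simultaneously. -/
lemma exists_forall_of_generic_on_lines {K E J : Type} [Field K] [Infinite K] [AddCommGroup E]
    [Module K E] (P : J → E → Prop)
    (hline : ∀ j x y, P j x → {τ : K | ¬ P j (x + τ • y)}.Finite) (s : Finset J)
    (hs : ∀ j ∈ s, ∃ x, P j x) : ∃ x, ∀ j ∈ s, P j x := by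
  classical
  induction s using Finset.induction_on with
  | empty => exact ⟨0, by simp⟩
  | insert a s ha ih =>
    obtain ⟨x, hx⟩ := ih fun j hj => hs j (by simp [hj])
    obtain ⟨y, hy⟩ := hs a (by simp)
    have h1 : {τ : K | ¬ P a (x + τ • (y - x))}.Finite := by
      refine ((hline a y (x - y) hy).preimage
        (f := fun τ : K => 1 - τ) (fun _ _ _ _ h => by simpa using h)).subset fun τ hτ => ?_
      simp only [Set.mem_preimage, Set.mem_ofPred_eq] at hτ ⊢
      convert hτ using 2
      module
    have h2 : (⋃ j ∈ s, {τ : K | ¬ P j (x + τ • (y - x))}).Finite :=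
      s.finite_toSet.biUnion fun j hj => hline j x _ (hx j hj)
    obtain ⟨τ, hτ⟩ := (h1.union h2).exists_notMem
    simp only [Set.mem_union, Set.mem_ofPred_eq, Set.mem_iUnion, not_or, not_exists, not_not] at hτ
    refine ⟨x + τ • (y - x), fun j hj => ?_⟩
    rcases Finset.mem_insert.1 hj with rfl | hj
    · exact hτ.1
    · exact hτ.2 j hj

section Tensor

/-- The action of `g + t` on `U[t]`, where a polynomial is recorded by its coefficients. -/
def addShift {K U : Type} [Field K] [AddCommGroup U] [Module K U] (g : Module.End K U) :
    Module.End K (ℕ → U) where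
  toFun u k := g (u k) + (if k = 0 then 0 else u (k - 1))
  map_add' u v := by
    ext k
    by_cases h : k = 0 <;> simp [h]; abel
  map_smul' a u := by
    ext k
    by_cases h : k = 0 <;> simp [h]

/-- The action of `g + x` on `U[x] / (x ^ 2)`. -/
def addEps {K U : Type} [Field K] [AddCommGroup U] [Module K U] (g : Module.End K U) :
    Module.End K (U × U) where
  toFun u := (g u.1, u.1 + g u.2)
  map_add' u v := by ext <;> simp; abel
  map_smul' a u := by ext <;> simp

lemma addEps_pow_apply {K U : Type} [Field K] [AddCommGroup U] [Module K U] (g : Module.End K U)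
    (N : ℕ) (u : U × U) :
    (addEps g ^ (N + 1)) u =
      ((g ^ (N + 1)) u.1, (g ^ N) (((N : K) + 1) • u.1 + g u.2)) := by
  induction N with
  | zero => simp [addEps]
  | succ n ih =>
    rw [pow_succ', Module.End.mul_apply, ih]
    simp only [addEps, LinearMap.coe_mk, AddHom.coe_mk, pow_succ', Module.End.mul_apply, map_add,
      map_smul, Prod.mk.injEq, true_and]
    have h : (g ^ n) (g u.1) = g ((g ^ n) u.1) := by
      rw [← Module.End.mul_apply, ← Module.End.mul_apply, ← pow_succ, ← pow_succ']
    push_cast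
    module

/-- The injection of `U[t] / (t ^ (n + 1))` into `(U[x] / (x ^ 2))[s] / (s ^ n)` given by
`t ↦ s + x`. -/
def splitEps (K : Type) {U : Type} [Field K] [AddCommGroup U] [Module K U] :
    (ℕ → U) →ₗ[K] (ℕ → U × U) where
  toFun u k := (u k, ((k : K) + 1) • u (k + 1))
  map_add' u v := by ext <;> simp
  map_smul' a u := by ext <;> simp [smul_comm a]

lemma splitEps_addShift {K U : Type} [Field K] [AddCommGroup U] [Module K U]
    (g : Module.End K U) (u : ℕ → U) :
    splitEps K (addShift g u) = addShift (addEps g) (splitEps K u) := by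
  funext k
  rcases k with _ | k
  · simp [splitEps, addShift, addEps, add_comm]
  · simp only [splitEps, addShift, addEps, LinearMap.coe_mk, AddHom.coe_mk]
    ext
    · simp
    · simp
      module

lemma splitEps_addShift_pow {K U : Type} [Field K] [AddCommGroup U] [Module K U]
    (g : Module.End K U) (N : ℕ) (u : ℕ → U) :
    splitEps K ((addShift g ^ N) u) =
      (addShift (addEps g) ^ N) (splitEps K u) := by
  induction N with
  | zero => simp
  | succ n ih => simp only [pow_succ', Module.End.mul_apply, splitEps_addShift, ih]

/-- Tensoring with `K[t] / (t ^ (n + 1))` preserves the injectivity half of the strong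
Lefschetz property in characteristic zero. -/
lemma addShift_pow_injective {K : Type} [Field K] [CharZero K] (n : ℕ) :
    ∀ {U : Type} [AddCommGroup U] [Module K U] (g : Module.End K U) (ℳ : ℤ → Submodule K U)
      (_ : ∀ q, ∀ u ∈ ℳ q, g u ∈ ℳ (q + 1)) (s : ℤ)
      (_ : ∀ (q : ℤ) (N : ℕ), 2 * q + N = s → ∀ u ∈ ℳ q, (g ^ N) u = 0 → u = 0)
      (q : ℤ) (N : ℕ) (_ : 2 * q + N = s + n) (u : ℕ → U) (_ : ∀ k ≤ n, u k ∈ ℳ (q - k))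
      (_ : ∀ k ≤ n, (addShift g ^ N) u k = 0), ∀ k ≤ n, u k = 0 := by
  induction n with
  | zero =>
    intro U _ _ g ℳ hg s hinj q N hN u hu h k hk
    obtain rfl : k = 0 := by omega
    have h0 : ∀ N, (addShift g ^ N) u 0 = (g ^ N) (u 0) := by
      intro N
      induction N with
      | zero => simp
      | succ m ih => rw [pow_succ', Module.End.mul_apply, pow_succ', Module.End.mul_apply, ← ih]
                     simp [addShift]
    refine hinj q N (by simpa using hN) (u 0) (by simpa using hu 0 le_rfl) ?_
    rw [← h0]
    exact h 0 le_rfl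
  | succ n ih =>
    intro U _ _ g ℳ hg s hinj q N hN u hu h k hk
    have key := ih (addEps g) (fun q => (ℳ q).prod (ℳ (q - 1)))
      (by
        rintro q ⟨a, b⟩ ⟨ha, hb⟩
        refine ⟨hg _ _ ha, ?_⟩
        have := hg _ _ hb
        simp only [sub_add_cancel, add_sub_cancel_right] at this ⊢
        exact add_mem ha this) (s + 1)
      (by
        rintro q N hN ⟨a, b⟩ ⟨ha, hb⟩ h0
        simp only at ha hb
        rcases N with _ | N
        · simpa using h0
        rw [addEps_pow_apply] at h0
        simp only [Prod.mk_eq_zero] at h0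
        have hgb := hg _ _ hb
        rw [sub_add_cancel] at hgb
        have h1 := hinj q N (by push_cast at hN; linarith) _
          (add_mem (Submodule.smul_mem _ ((N : K) + 1) ha) hgb) h0.2
        have hN0 : ((N : K) + 1) ≠ 0 := by exact_mod_cast N.succ_ne_zero
        have h2 : b = 0 := by
          refine hinj (q - 1) (N + 2) (by push_cast at hN ⊢; linarith) _ hb ?_
          have h3 : (g ^ (N + 1)) (((N : K) + 1) • a + g b) = 0 := by rw [h1, map_zero]
          rw [map_add, map_smul, h0.1, smul_zero, zero_add] at h3
          rwa [pow_succ, Module.End.mul_apply]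
        rw [h2, map_zero, add_zero] at h1
        simp [h2, (smul_eq_zero.1 h1).resolve_left hN0])
      q N (by push_cast at hN ⊢; linarith) (splitEps K u)
      (by
        intro k hk
        refine ⟨hu k (by omega), Submodule.smul_mem _ _ ?_⟩
        have := hu (k + 1) (by omega)
        push_cast at this
        rwa [← sub_sub] at this)
      (by
        intro k hk
        rw [← splitEps_addShift_pow]
        simp [splitEps, h k (by omega), h (k + 1) (by omega)])
    rcases k with _ | k
    · exact congrArg Prod.fst (key 0 (by omega))
    · have h1 := congrArg Prod.snd (key k (by omega))
      have hk0 : ((k : K) + 1) ≠ 0 := by exact_mod_cast k.succ_ne_zero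
      exact (smul_eq_zero.1 h1).resolve_left hk0

end Tensor

section JordanType

lemma sum_sub_mul_min {C δ : ℕ → ℕ} {D N : ℕ} (hC : Monotone C) (h0 : δ 0 = 0)
    (hCδ : ∀ n, C n + δ (n + 1) = δ n + D) (hN : ∀ n, N ≤ n → C n = D) (k : ℕ) :
    ∑ n ∈ Finset.range (N + 1), (C n - C (n - 1)) * min n k = δ k := by
  induction k with
  | zero => simp [h0]
  | succ k ih =>
    have key : ∀ M, ∑ n ∈ Finset.range (M + 1), (C n - C (n - 1)) * (if k < n then 1 else 0) + C k
        = C (max M k) := by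
      intro M
      induction M with
      | zero => simp
      | succ M ihM =>
        rw [Finset.sum_range_succ, add_right_comm, ihM]
        have := hC (Nat.le_succ M)
        by_cases hk : k < M + 1
        · rw [if_pos hk, max_eq_left (by omega), max_eq_left (by omega)]
          simp only [Nat.succ_eq_add_one, Nat.add_sub_cancel] at *
          omega
        · rw [if_neg hk, max_eq_right (by omega), max_eq_right (by omega)]
          simp
    have h1 : ∑ n ∈ Finset.range (N + 1), (C n - C (n - 1)) * min n (k + 1) =
        ∑ n ∈ Finset.range (N + 1), (C n - C (n - 1)) * min n k +
        ∑ n ∈ Finset.range (N + 1), (C n - C (n - 1)) * (if k < n then 1 else 0) := by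
      rw [← Finset.sum_add_distrib]
      refine Finset.sum_congr rfl fun n _ => ?_
      rw [← mul_add]
      congr 1
      split_ifs <;> omega
    have h2 := key N
    have h3 := hCδ k
    rw [hN _ (le_max_left N k)] at h2
    omega

lemma ker_pow_sup_range_mono {K V : Type} [Field K] [AddCommGroup V] [Module K V]
    (Z : Module.End K V) :
    Monotone fun n => LinearMap.ker (Z ^ n) ⊔ LinearMap.range Z := fun m n h =>
  sup_le_sup_right (fun x hx => by
    obtain ⟨k, rfl⟩ := Nat.exists_eq_add_of_le' h
    simp only [LinearMap.mem_ker] at *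
    rw [pow_add, Module.End.mul_apply, hx, map_zero]) _

variable {K : Type} [Field K] {V W : Type} [AddCommGroup V] [Module K V] [FiniteDimensional K V]
  [AddCommGroup W] [Module K W]

lemma finrank_map_add_finrank_ker_inf (f : V →ₗ[K] W) (S : Submodule K V) :
    Module.finrank K (S.map f) + Module.finrank K ↥(LinearMap.ker f ⊓ S) = Module.finrank K S := by
  have h := LinearMap.finrank_range_add_finrank_ker (f.domRestrict S)
  rw [LinearMap.range_domRestrict] at h
  rw [← h]
  have e := Submodule.comapSubtypeEquivOfLe (inf_le_right : LinearMap.ker f ⊓ S ≤ S)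
  have hk : LinearMap.ker (f.domRestrict S) = (LinearMap.ker f ⊓ S).comap S.subtype := by
    ext x
    simp
  rw [hk, e.finrank_eq]

lemma finrank_ker_pow_sup_range (Z : Module.End K V) (n : ℕ) :
    Module.finrank K ↥(LinearMap.ker (Z ^ n) ⊔ LinearMap.range Z) +
      Module.finrank K (LinearMap.ker (Z ^ (n + 1))) =
    Module.finrank K (LinearMap.ker (Z ^ n)) + Module.finrank K V := by
  have h1 := finrank_map_add_finrank_ker_inf (Z ^ n) (LinearMap.ker (Z ^ n) ⊔ LinearMap.range Z)
  have h2 : (LinearMap.ker (Z ^ n) ⊔ LinearMap.range Z).map (Z ^ n) =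
      LinearMap.range (Z ^ (n + 1)) := by
    rw [Submodule.map_sup, ← LinearMap.range_comp, pow_succ, Module.End.mul_eq_comp,
      (LinearMap.le_ker_iff_map).1 le_rfl, bot_sup_eq]
  rw [h2, inf_eq_left.2 le_sup_left] at h1
  have h3 := LinearMap.finrank_range_add_finrank_ker (Z ^ (n + 1))
  omega

lemma finrank_ker_pow_eq_sum {Z : Module.End K V} {N : ℕ} (hZ : Z ^ N = 0) (k : ℕ) :
    ∑ n ∈ Finset.range (N + 1),
      (Module.finrank K ↥(LinearMap.ker (Z ^ n) ⊔ LinearMap.range Z) -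
        Module.finrank K ↥(LinearMap.ker (Z ^ (n - 1)) ⊔ LinearMap.range Z)) * min n k =
    Module.finrank K (LinearMap.ker (Z ^ k)) := by
  refine sum_sub_mul_min
    (C := fun n => Module.finrank K ↥(LinearMap.ker (Z ^ n) ⊔ LinearMap.range Z))
    (δ := fun n => Module.finrank K (LinearMap.ker (Z ^ n))) (D := Module.finrank K V)
    (fun m n h => Submodule.finrank_mono (ker_pow_sup_range_mono Z h)) ?_
    (finrank_ker_pow_sup_range Z) (fun n hn => ?_) k
  · rw [pow_zero, Module.End.one_eq_id, LinearMap.ker_id, finrank_bot]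
  · rw [pow_eq_zero_of_le hn hZ, LinearMap.ker_zero, top_sup_eq, finrank_top]

lemma exists_isJordanType {Z : Module.End K V} {N : ℕ} (hZ : Z ^ N = 0) :
    ∃ d, IsJordanType K Z d := by
  refine ⟨∑ n ∈ Finset.range (N + 1), Multiset.replicate
      (Module.finrank K ↥(LinearMap.ker (Z ^ n) ⊔ LinearMap.range Z) -
        Module.finrank K ↥(LinearMap.ker (Z ^ (n - 1)) ⊔ LinearMap.range Z)) n, ?_, fun k => ?_⟩
  · intro n hn
    rw [Multiset.mem_sum] at hn
    obtain ⟨m, -, hm⟩ := hn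
    obtain ⟨h1, rfl⟩ := Multiset.mem_replicate.1 hm
    rcases Nat.eq_zero_or_pos n with rfl | h
    · simp at h1
    · exact h
  · rw [← finrank_ker_pow_eq_sum hZ k, ← Multiset.coe_mapAddMonoidHom, map_sum,
      ← Multiset.coe_sumAddMonoidHom, map_sum]
    simp

lemma IsJordanType.finrank_succ {Z : Module.End K V} {d : Multiset ℕ} (hd : IsJordanType K Z d)
    (n : ℕ) :
    Module.finrank K ↥(LinearMap.ker (Z ^ (n + 1)) ⊔ LinearMap.range Z) =
      Module.finrank K ↥(LinearMap.ker (Z ^ n) ⊔ LinearMap.range Z) + d.count (n + 1) := by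
  have h1 := finrank_ker_pow_sup_range Z n
  have h2 := finrank_ker_pow_sup_range Z (n + 1)
  rw [hd.2, hd.2] at h1 h2
  simp only [add_assoc, Nat.reduceAdd] at h1 h2 ⊢
  have key : ∀ e : Multiset ℕ, (e.map fun m => min m n).sum + (e.map fun m => min m (n + 2)).sum
      + e.count (n + 1) = 2 * (e.map fun m => min m (n + 1)).sum := by
    intro e
    induction e using Multiset.induction_on with
    | empty => simp
    | cons a e ih =>
      simp only [Multiset.map_cons, Multiset.sum_cons, Multiset.count_cons]
      split_ifs <;> omega
  have := key d
  omega

lemma IsJordanType.mem_iff {Z : Module.End K V} {d : Multiset ℕ} (hd : IsJordanType K Z d)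
    (n : ℕ) :
    n + 1 ∈ d ↔ LinearMap.ker (Z ^ (n + 1)) ⊔ LinearMap.range Z ≠
      LinearMap.ker (Z ^ n) ⊔ LinearMap.range Z := by
  have h := hd.finrank_succ n
  rw [← Multiset.count_pos]
  constructor
  · intro hp he
    rw [he] at h
    omega
  · intro hne
    by_contra h0
    have hle : LinearMap.ker (Z ^ n) ⊔ LinearMap.range Z ≤
        LinearMap.ker (Z ^ (n + 1)) ⊔ LinearMap.range Z := ker_pow_sup_range_mono Z (Nat.le_succ n)
    exact hne (Submodule.eq_of_le_of_finrank_eq hle (by omega)).symm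

/-- The subspaces `ker Z ^ n + range Z` do not change between consecutive block sizes. -/
lemma IsJordanType.ker_sup_range_eq {Z : Module.End K V} {d : Multiset ℕ}
    (hd : IsJordanType K Z d) {m n : ℕ} (hmn : m ≤ n) (h : ∀ k ∈ d, m < k → n < k) :
    LinearMap.ker (Z ^ m) ⊔ LinearMap.range Z = LinearMap.ker (Z ^ n) ⊔ LinearMap.range Z := by
  induction n, hmn using Nat.le_induction with
  | base => rfl
  | succ n hmn ih =>
    rw [ih fun k hk hmk => (Nat.lt_succ_self n).trans (h k hk hmk)]
    by_contra hne
    exact lt_irrefl _ (h (n + 1) ((hd.mem_iff n).2 (Ne.symm hne)) (by omega))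

lemma IsJordanType.ker_sup_range_nextSize {Z : Module.End K V} {d : Multiset ℕ}
    (hd : IsJordanType K Z d) {s : ℕ} {f : Fin s → ℕ} (hf : DistinctSizes d f) (i : Fin s) :
    LinearMap.ker (Z ^ nextSize f i) ⊔ LinearMap.range Z =
      LinearMap.ker (Z ^ (f i - 1)) ⊔ LinearMap.range Z := by
  have hpos : 0 < f i := hd.1 _ ((hf.2 _).1 ⟨i, rfl⟩)
  refine hd.ker_sup_range_eq ?_ fun k hk hlt => ?_
  · unfold nextSize
    split_ifs with h
    · have : f ⟨i + 1, h⟩ < f i := hf.1 (Fin.lt_def.2 (by simp))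
      omega
    · omega
  · obtain ⟨j, rfl⟩ := (hf.2 k).2 hk
    suffices h : j ≤ i by
      have := hf.1.antitone h
      omega
    by_contra h
    have hij : (i : ℕ) < j := Fin.lt_def.1 (not_le.1 h)
    unfold nextSize at hlt
    have hs : (i : ℕ) + 1 < s := lt_of_le_of_lt hij j.2
    rw [dif_pos hs] at hlt
    have := hf.1.antitone (show (⟨i + 1, hs⟩ : Fin s) ≤ j from Fin.le_def.2 hij)
    omega

lemma exists_distinctSizes (d : Multiset ℕ) : ∃ (s : ℕ) (f : Fin s → ℕ), DistinctSizes d f := by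
  refine ⟨_, fun i => d.toFinset.orderEmbOfFin rfl i.rev, fun i j h => ?_, fun n => ?_⟩
  · simpa using h
  · have h := Finset.range_orderEmbOfFin d.toFinset rfl
    rw [← Multiset.mem_toFinset, ← Finset.mem_coe, ← h]
    constructor
    · rintro ⟨i, rfl⟩
      exact ⟨_, rfl⟩
    · rintro ⟨i, rfl⟩
      exact ⟨i.rev, by simp⟩

end JordanType

section Grading

variable {K : Type} [Field K] {V W : Type} [AddCommGroup V] [Module K V]
  [AddCommGroup W] [Module K W]

/-- The projections onto the pieces of a grading of `V` supported on the finite set `S`. -/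
structure IsGradingProj (π : ℤ → Module.End K V) (S : Finset ℤ) : Prop where
  idem : ∀ q x, π q (π q x) = π q x
  ortho : ∀ q q' x, q ≠ q' → π q (π q' x) = 0
  sum : ∀ x, ∑ q ∈ S, π q x = x

namespace IsGradingProj

variable {π : ℤ → Module.End K V} {S : Finset ℤ}

lemma apply_of_eq (h : IsGradingProj π S) {q q' : ℤ} {x : V} (hx : π q' x = x) :
    π q x = if q' = q then x else 0 := by
  split_ifs with hq
  · rw [← hq, hx]
  · rw [← hx, h.ortho _ _ _ (Ne.symm hq)]

lemma eq_zero_of_notMem (h : IsGradingProj π S) {q : ℤ} {x : V} (hx : π q x = x) (hq : q ∉ S) :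
    x = 0 := by
  rw [← h.sum x]
  refine Finset.sum_eq_zero fun q' hq' => ?_
  rw [h.apply_of_eq hx, if_neg]
  rintro rfl
  exact hq hq'

lemma mem_range_iff (h : IsGradingProj π S) {q : ℤ} {x : V} :
    x ∈ LinearMap.range (π q) ↔ π q x = x := by
  constructor
  · rintro ⟨y, rfl⟩
    exact h.idem q y
  · intro hx
    exact ⟨x, hx⟩

/-- A graded quotient has a basis of homogeneous elements. -/
lemma exists_homogeneous_basis [FiniteDimensional K V] (h : IsGradingProj π S) (T : Submodule K V)
    (hT : ∀ q, ∀ x ∈ T, π q x ∈ T) (f : V →ₗ[K] W) :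
    ∃ (w : Fin (Module.finrank K (T.map f)) → V) (p : Fin (Module.finrank K (T.map f)) → ℤ),
      (∀ i, w i ∈ T) ∧ (∀ i, π (p i) (w i) = w i) ∧ LinearIndependent K (fun i => f (w i)) ∧
      Submodule.span K (Set.range fun i => f (w i)) = T.map f := by
  let s : Set W := {x | ∃ y ∈ T, ∃ q, π q y = y ∧ f y = x}
  have hs : Submodule.span K s = T.map f := by
    apply le_antisymm
    · rw [Submodule.span_le]
      rintro _ ⟨y, hy, -, -, rfl⟩
      exact Submodule.mem_map_of_mem hy
    · rintro _ ⟨y, hy, rfl⟩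
      rw [← h.sum y, map_sum]
      exact Submodule.sum_mem _ fun q _ =>
        Submodule.subset_span ⟨_, hT q y hy, q, h.idem q y, rfl⟩
  obtain ⟨b, hbs, hspan, hli⟩ := exists_linearIndependent K s
  rw [hs] at hspan
  have hfd : FiniteDimensional K (T.map f) := inferInstance
  have hle : ∀ x ∈ b, x ∈ T.map f := fun x hx => hspan ▸ Submodule.subset_span hx
  have hli' : LinearIndependent K (fun x : b => (⟨x, hle x x.2⟩ : T.map f)) :=
    LinearIndependent.of_comp (T.map f).subtype hli
  have : Finite b := hli'.finite
  have : Fintype b := Fintype.ofFinite b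
  have hcard : Module.finrank K (T.map f) = Fintype.card b := by
    rw [← hspan, finrank_span_set_eq_card hli, Set.toFinset_card]
  let e : Fin (Module.finrank K (T.map f)) ≃ b := (Fintype.equivFinOfCardEq hcard.symm).symm
  choose w hwT p hp hw using fun x : b => hbs x.2
  refine ⟨fun i => w (e i), fun i => p (e i), fun i => hwT _, fun i => hp _, ?_, ?_⟩
  · simp only [hw]
    exact hli.comp e e.injective
  · simp only [hw]
    refine Eq.trans ?_ hspan
    congr 1
    rw [show (fun i => ((e i : b) : W)) = Subtype.val ∘ e from rfl, e.surjective.range_comp]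
    simp

lemma finrank_map_inf_range [FiniteDimensional K V] (h : IsGradingProj π S) {T : Submodule K V}
    {f : V →ₗ[K] W} (hf : ∀ q x, f x = 0 → f (π q x) = 0)
    {ι : Type*} [Fintype ι] {w : ι → V} {p : ι → ℤ} (hwT : ∀ i, w i ∈ T)
    (hp : ∀ i, π (p i) (w i) = w i) (hli : LinearIndependent K (fun i => f (w i)))
    (hspan : T.map f ≤ Submodule.span K (Set.range fun i => f (w i))) (q : ℤ) :
    Module.finrank K ((T ⊓ LinearMap.range (π q)).map f) =
      (Finset.univ.filter fun i => p i = q).card := by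
  have key : (T ⊓ LinearMap.range (π q)).map f =
      Submodule.span K (Set.range fun i : {i // p i = q} => f (w i)) := by
    apply le_antisymm
    · rintro _ ⟨y, ⟨hyT, hyq⟩, rfl⟩
      rw [SetLike.mem_coe, h.mem_range_iff] at hyq
      obtain ⟨a, ha⟩ :=
        (Submodule.mem_span_range_iff_exists_fun K).1 (hspan (Submodule.mem_map_of_mem hyT))
      have h0 : f (y - ∑ i, a i • w i) = 0 := by simp [ha]
      have h1 := hf q _ h0
      rw [map_sub, hyq, map_sub, sub_eq_zero] at h1
      rw [h1, map_sum, map_sum]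
      refine Submodule.sum_mem _ fun i _ => ?_
      rw [map_smul, map_smul, h.apply_of_eq (hp i)]
      split_ifs with hi
      · exact Submodule.smul_mem _ _ (Submodule.subset_span ⟨⟨i, hi⟩, rfl⟩)
      · simp
    · rw [Submodule.span_le]
      rintro _ ⟨⟨i, rfl⟩, rfl⟩
      exact Submodule.mem_map_of_mem ⟨hwT i, h.mem_range_iff.2 (hp i)⟩
  rw [key]
  exact (finrank_span_eq_card
    (hli.comp (Subtype.val : {i // p i = q} → ι) Subtype.val_injective)).trans
    (Fintype.card_subtype _)

end IsGradingProj

end Grading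

section Strings

variable {K : Type} [Field K] {V : Type} [AddCommGroup V] [Module K V]

/-- The subspace `ker Z ^ n + range Z`. -/
def kerSup (Z : Module.End K V) (n : ℕ) : Submodule K V :=
  LinearMap.ker (Z ^ n) ⊔ LinearMap.range Z

/-- A homogeneous Jordan basis for `Z`, organised by the sizes of the blocks. -/
structure StringBasis (Z : Module.End K V) (π : ℤ → Module.End K V) (M : ℕ) where
  u : ℕ → ℕ
  w : ∀ n, Fin (u n) → V
  p : ∀ n, Fin (u n) → ℤ
  pow_w : ∀ n i, (Z ^ n) (w n i) = 0
  proj_w : ∀ n i, π (p n i) (w n i) = w n i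
  indep : ∀ n, LinearIndependent K (fun i => (kerSup Z (n - 1)).mkQ (w n i))
  span : ∀ n, Submodule.span K (Set.range fun i => (kerSup Z (n - 1)).mkQ (w n i)) =
    (LinearMap.ker (Z ^ n)).map (kerSup Z (n - 1)).mkQ
  b : Module.Basis (Σ n : Fin (M + 1), Fin (u n) × Fin n) K V
  b_apply : ∀ x, b x = (Z ^ (x.2.2 : ℕ)) (w x.1 x.2.1)

lemma proj_pow {Z : Module.End K V} {π : ℤ → Module.End K V}
    (hZ : ∀ q x, Z (π q x) = π (q + 1) (Z x)) (n : ℕ) (q : ℤ) (x : V) :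
    (Z ^ n) (π q x) = π (q + n) ((Z ^ n) x) := by
  induction n with
  | zero => simp
  | succ n ih =>
    rw [pow_succ', Module.End.mul_apply, ih, hZ, Module.End.mul_apply]
    push_cast
    rw [add_assoc]

lemma proj_mem_ker_pow {Z : Module.End K V} {π : ℤ → Module.End K V}
    (hZ : ∀ q x, Z (π q x) = π (q + 1) (Z x)) (n : ℕ) (q : ℤ) {x : V}
    (hx : x ∈ LinearMap.ker (Z ^ n)) : π q x ∈ LinearMap.ker (Z ^ n) := by
  rw [LinearMap.mem_ker] at *
  rw [proj_pow hZ, hx, map_zero]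

lemma proj_mem_kerSup {Z : Module.End K V} {π : ℤ → Module.End K V}
    (hZ : ∀ q x, Z (π q x) = π (q + 1) (Z x)) (n : ℕ) (q : ℤ) {x : V}
    (hx : x ∈ kerSup Z n) : π q x ∈ kerSup Z n := by
  obtain ⟨y, hy, _, ⟨v, rfl⟩, rfl⟩ := Submodule.mem_sup.1 hx
  rw [map_add]
  refine Submodule.add_mem_sup (proj_mem_ker_pow hZ n q hy) ⟨π (q - 1) v, ?_⟩
  rw [hZ, sub_add_cancel]

lemma mem_kerSup_of_commute {Z G : Module.End K V} (hGZ : ∀ x, G (Z x) = Z (G x)) (n : ℕ) {x : V}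
    (hx : x ∈ kerSup Z n) : G x ∈ kerSup Z n := by
  have hpow : ∀ y, G ((Z ^ n) y) = (Z ^ n) (G y) := by
    have : Commute G (Z ^ n) := Commute.pow_right (LinearMap.ext hGZ) n
    exact fun y => LinearMap.congr_fun this y
  obtain ⟨y, hy, _, ⟨v, rfl⟩, rfl⟩ := Submodule.mem_sup.1 hx
  rw [LinearMap.mem_ker] at hy
  rw [map_add, hGZ]
  exact Submodule.add_mem_sup (by rw [LinearMap.mem_ker, ← hpow, hy, map_zero]) ⟨_, rfl⟩

lemma finrank_map_mkQ_ker_pow [FiniteDimensional K V] (Z : Module.End K V) (n : ℕ) :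
    Module.finrank K ((LinearMap.ker (Z ^ n)).map (kerSup Z (n - 1)).mkQ) =
      Module.finrank K (kerSup Z n) - Module.finrank K (kerSup Z (n - 1)) := by
  have hle : kerSup Z (n - 1) ≤ kerSup Z n := ker_pow_sup_range_mono Z (Nat.sub_le n 1)
  have h := finrank_map_add_finrank_ker_inf (kerSup Z (n - 1)).mkQ (kerSup Z n)
  rw [Submodule.ker_mkQ, inf_eq_left.2 hle] at h
  have h2 : (LinearMap.ker (Z ^ n)).map (kerSup Z (n - 1)).mkQ =
      (kerSup Z n).map (kerSup Z (n - 1)).mkQ := by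
    change _ = (LinearMap.ker (Z ^ n) ⊔ LinearMap.range Z).map _
    rw [Submodule.map_sup, left_eq_sup]
    have : (LinearMap.range Z).map (kerSup Z (n - 1)).mkQ = ⊥ := by
      rw [← LinearMap.le_ker_iff_map, Submodule.ker_mkQ]
      exact le_sup_right
    rw [this]
    exact bot_le
  rw [h2]
  omega

lemma nonempty_stringBasis [FiniteDimensional K V] {Z : Module.End K V} {π : ℤ → Module.End K V}
    {S : Finset ℤ} (hπ : IsGradingProj π S) (hZ : ∀ q x, Z (π q x) = π (q + 1) (Z x)) {M : ℕ}
    (hM : Z ^ M = 0) : Nonempty (StringBasis Z π M) := by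
  choose w p hwT hp hli hspan using fun n =>
    hπ.exists_homogeneous_basis (LinearMap.ker (Z ^ n))
      (fun q x hx => proj_mem_ker_pow hZ n q hx) (kerSup Z (n - 1)).mkQ
  let u : ℕ → ℕ := fun n =>
    Module.finrank K ((LinearMap.ker (Z ^ n)).map (kerSup Z (n - 1)).mkQ)
  let e : (Σ n : Fin (M + 1), Fin (u n) × Fin n) → V := fun x => (Z ^ (x.2.2 : ℕ)) (w x.1 x.2.1)
  let T := Submodule.span K (Set.range e)
  have hmem : ∀ n ≤ M, ∀ i k, (Z ^ k) (w n i) ∈ T := by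
    intro n hn i k
    by_cases hk : k < n
    · exact Submodule.subset_span ⟨⟨⟨n, by omega⟩, i, ⟨k, hk⟩⟩, rfl⟩
    · obtain ⟨l, rfl⟩ := Nat.exists_eq_add_of_le' (not_lt.1 hk)
      rw [pow_add, Module.End.mul_apply, LinearMap.mem_ker.1 (hwT n i), map_zero]
      exact T.zero_mem
  have hZT : ∀ x ∈ T, Z x ∈ T := by
    intro x hx
    have : T ≤ T.comap Z := by
      rw [Submodule.span_le]
      rintro _ ⟨⟨n, i, k⟩, rfl⟩
      have := hmem n (by omega) i (k + 1)
      rwa [pow_succ', Module.End.mul_apply] at this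
    exact this hx
  have hker : ∀ n ≤ M, LinearMap.ker (Z ^ n) ≤ T ⊔ LinearMap.range Z := by
    intro n
    induction n with
    | zero => intro _ x hx; simp at hx; simp [hx]
    | succ n ih =>
      intro hn y hy
      have h1 : (kerSup Z n).mkQ y ∈
          (Submodule.span K (Set.range (w (n + 1)))).map (kerSup Z n).mkQ := by
        rw [Submodule.map_span, ← Set.range_comp]
        exact (hspan (n + 1)).ge (Submodule.mem_map_of_mem hy)
      obtain ⟨v, hv, hvy⟩ := h1
      have hvT : v ∈ T := by
        refine (Submodule.span_le.2 ?_ : Submodule.span K (Set.range (w (n + 1))) ≤ T) hv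
        rintro _ ⟨i, rfl⟩
        simpa using hmem (n + 1) hn i 0
      have h2 : y - v ∈ kerSup Z n := by
        rw [← Submodule.ker_mkQ (kerSup Z n), LinearMap.mem_ker, map_sub, hvy, sub_self]
      have h3 : kerSup Z n ≤ T ⊔ LinearMap.range Z := sup_le (ih (by omega)) le_sup_right
      rw [← sub_add_cancel y v]
      exact add_mem (h3 h2) (Submodule.mem_sup_left hvT)
  have htop : ∀ x, x ∈ T ⊔ LinearMap.range Z := fun x =>
    hker M le_rfl (by simp [hM])
  have hpow : ∀ m x, ∃ y, x - (Z ^ m) y ∈ T := by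
    intro m
    induction m with
    | zero => exact fun x => ⟨x, by simp⟩
    | succ m ih =>
      intro x
      obtain ⟨t, ht, _, ⟨v, rfl⟩, hx⟩ := Submodule.mem_sup.1 (htop x)
      obtain ⟨y, hy⟩ := ih v
      refine ⟨y, ?_⟩
      rw [← hx, pow_succ', Module.End.mul_apply, add_sub_assoc, ← map_sub]
      exact add_mem ht (hZT _ hy)
  have hT : ⊤ ≤ T := fun x _ => by
    obtain ⟨y, hy⟩ := hpow M x
    simpa [hM] using hy
  have hcard : Fintype.card (Σ n : Fin (M + 1), Fin (u n) × Fin n) = Module.finrank K V := by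
    have h := finrank_ker_pow_eq_sum hM M
    rw [hM, LinearMap.ker_zero, finrank_top] at h
    rw [← h, Finset.sum_range]
    simp only [Fintype.card_sigma, Fintype.card_prod, Fintype.card_fin]
    refine Finset.sum_congr rfl fun n _ => ?_
    rw [min_eq_left (by omega)]
    exact congrArg (· * (n : ℕ)) (finrank_map_mkQ_ker_pow Z n)
  exact ⟨⟨u, w, p, fun n i => hwT n i, hp, hli, hspan, basisOfTopLeSpanOfCardEqFinrank e hT hcard,
    fun x => by simp [e]⟩⟩

end Strings

section Degeneration

variable {K : Type} [Field K] {V : Type} [AddCommGroup V] [Module K V]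

lemma forall_mem_of_basis {ι : Type*} (b : Module.Basis ι K V) {T : Submodule K V}
    (h : ∀ i, b i ∈ T) (v : V) : v ∈ T :=
  (Submodule.span_le.2 (Set.range_subset_iff.2 h) : Submodule.span K (Set.range b) ≤ T)
    (b.mem_span v)

/-- The endomorphism of `V ⧸ kerSup Z m` induced by `G`. -/
noncomputable def quotMap {Z G : Module.End K V} (hGZ : ∀ x, G (Z x) = Z (G x)) (m : ℕ) :
    Module.End K (V ⧸ kerSup Z m) :=
  (kerSup Z m).mapQ (kerSup Z m) G fun _ hx => mem_kerSup_of_commute hGZ m hx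

lemma quotMap_pow_mkQ {Z G : Module.End K V} (hGZ : ∀ x, G (Z x) = Z (G x)) (m N : ℕ) (x : V) :
    (quotMap hGZ m ^ N) ((kerSup Z m).mkQ x) = (kerSup Z m).mkQ ((G ^ N) x) := by
  induction N generalizing x with
  | zero => simp
  | succ N ih =>
    rw [pow_succ, Module.End.mul_apply, pow_succ, Module.End.mul_apply, ← ih]
    rfl

namespace StringBasis

variable {Z : Module.End K V} {π : ℤ → Module.End K V} {M : ℕ} (sb : StringBasis Z π M)

lemma pow_apply_b (m : ℕ) (n : Fin (M + 1)) (i : Fin (sb.u n)) (k : Fin n) :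
    (Z ^ m) (sb.b ⟨n, i, k⟩) =
      if h : (k : ℕ) + m < n then sb.b ⟨n, i, ⟨k + m, h⟩⟩ else 0 := by
  have h0 : (Z ^ m) (sb.b ⟨n, i, k⟩) = (Z ^ (m + (k : ℕ))) (sb.w n i) := by
    rw [sb.b_apply, pow_add, Module.End.mul_apply]
  rw [h0]
  split_ifs with h
  · rw [sb.b_apply, add_comm]
  · obtain ⟨l, hl⟩ := Nat.exists_eq_add_of_le' (not_lt.1 h)
    rw [add_comm, hl, pow_add, Module.End.mul_apply, sb.pow_w, map_zero]

lemma apply_b (n : Fin (M + 1)) (i : Fin (sb.u n)) (k : Fin n) :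
    Z (sb.b ⟨n, i, k⟩) = if h : (k : ℕ) + 1 < n then sb.b ⟨n, i, ⟨k + 1, h⟩⟩ else 0 := by
  simpa using sb.pow_apply_b 1 n i k

lemma repr_pow_add (m : ℕ) (n : Fin (M + 1)) (i : Fin (sb.u n)) (k : Fin n)
    (h : (k : ℕ) + m < n) (v : V) :
    sb.b.repr ((Z ^ m) v) ⟨n, i, ⟨k + m, h⟩⟩ = sb.b.repr v ⟨n, i, k⟩ := by
  suffices sb.b.coord ⟨n, i, ⟨k + m, h⟩⟩ ∘ₗ Z ^ m = sb.b.coord ⟨n, i, k⟩ from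
    LinearMap.congr_fun this v
  refine sb.b.ext fun ⟨n', i', k'⟩ => ?_
  rw [LinearMap.comp_apply, pow_apply_b, Module.Basis.coord_apply, Module.Basis.coord_apply,
    Module.Basis.repr_self]
  classical
  by_cases hx : (⟨n', i', k'⟩ : Σ n : Fin (M + 1), Fin (sb.u n) × Fin n) = ⟨n, i, k⟩
  · cases hx
    rw [dif_pos h, Module.Basis.repr_self]
    simp
  · rw [Finsupp.single_apply, if_neg hx]
    split_ifs with h'
    · rw [Module.Basis.repr_self, Finsupp.single_apply, if_neg]
      intro he
      apply hx
      obtain ⟨rfl, he⟩ := Sigma.mk.inj_iff.1 he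
      simp only [heq_eq_eq, Prod.mk.injEq, Fin.mk.injEq, Nat.add_right_cancel_iff] at he
      rw [he.1, Fin.ext he.2]
    · simp

lemma repr_pow_of_lt (m : ℕ) (n : Fin (M + 1)) (i : Fin (sb.u n)) (k : Fin n)
    (h : (k : ℕ) < m) (v : V) : sb.b.repr ((Z ^ m) v) ⟨n, i, k⟩ = 0 := by
  suffices sb.b.coord ⟨n, i, k⟩ ∘ₗ Z ^ m = 0 from LinearMap.congr_fun this v
  refine sb.b.ext fun ⟨n', i', k'⟩ => ?_
  rw [LinearMap.comp_apply, pow_apply_b, Module.Basis.coord_apply]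
  classical
  split_ifs with h'
  · rw [Module.Basis.repr_self, Finsupp.single_apply, if_neg]
    · rfl
    · intro he
      obtain ⟨rfl, he⟩ := Sigma.mk.inj_iff.1 he
      simp only [heq_eq_eq, Prod.mk.injEq, Fin.ext_iff] at he
      omega
  · simp

/-- The weight of a basis vector. -/
def wt (x : Σ n : Fin (M + 1), Fin (sb.u n) × Fin n) : ℕ := 2 * x.2.2 + (M - x.1)

/-- The subspace spanned by the basis vectors of weight at least `m`. -/
def wtSub (m : ℕ) : Submodule K V where
  carrier := {v | ∀ x, sb.wt x < m → sb.b.repr v x = 0}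
  add_mem' hv hw x hx := by simp [hv x hx, hw x hx]
  zero_mem' := by simp
  smul_mem' a v hv x hx := by simp [hv x hx]

lemma wtSub_anti {m m' : ℕ} (h : m ≤ m') : sb.wtSub m' ≤ sb.wtSub m :=
  fun _ hv x hx => hv x (hx.trans_le h)

lemma b_mem_wtSub (x) : sb.b x ∈ sb.wtSub (sb.wt x) := by
  classical
  intro y hy
  rw [Module.Basis.repr_self, Finsupp.single_apply, if_neg]
  rintro rfl
  exact lt_irrefl _ hy

lemma pow_mem_wtSub (m : ℕ) {l : ℕ} {v : V} (hv : v ∈ sb.wtSub l) :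
    (Z ^ m) v ∈ sb.wtSub (l + 2 * m) := by
  rintro ⟨n, i, k⟩ hx
  by_cases hk : (k : ℕ) < m
  · exact sb.repr_pow_of_lt m n i k hk v
  · have h := sb.repr_pow_add m n i ⟨k - m, by omega⟩ (by simp; omega) v
    have hk' : (⟨(k : ℕ) - m + m, by omega⟩ : Fin n) = k := Fin.ext (by simp; omega)
    simp only [hk'] at h
    rw [h]
    apply hv
    simp only [wt] at hx ⊢
    omega

lemma ker_pow_le_wtSub (m : ℕ) : LinearMap.ker (Z ^ m) ≤ sb.wtSub (M - m) := by
  rintro v hv ⟨n, i, k⟩ hx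
  simp only [wt] at hx
  have h : (k : ℕ) + m < n := by omega
  rw [← sb.repr_pow_add m n i k h v, LinearMap.mem_ker.1 hv]
  simp

lemma mem_wtSub_of_mem_kerSup {n : ℕ} (h1 : 1 ≤ n) (hn : n ≤ M) {v : V} (hv : (Z ^ n) v = 0)
    (hv' : v ∈ kerSup Z (n - 1)) : v ∈ sb.wtSub (M - n + 1) := by
  obtain ⟨y, hy, _, ⟨x, rfl⟩, rfl⟩ := Submodule.mem_sup.1 hv'
  refine add_mem (sb.wtSub_anti (by omega) (sb.ker_pow_le_wtSub _ hy)) ?_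
  have hyn : (Z ^ n) y = 0 := by
    obtain ⟨m, rfl⟩ := Nat.exists_eq_add_of_le' h1
    rw [pow_succ', Module.End.mul_apply]
    rw [Nat.add_sub_cancel, LinearMap.mem_ker] at hy
    rw [hy, map_zero]
  have hx : x ∈ LinearMap.ker (Z ^ (n + 1)) := by
    rw [map_add, hyn, zero_add] at hv
    rwa [LinearMap.mem_ker, pow_succ, Module.End.mul_apply]
  have := sb.pow_mem_wtSub 1 (sb.ker_pow_le_wtSub _ hx)
  rw [pow_one] at this
  exact sb.wtSub_anti (by omega) this

/-- The endomorphism multiplying a basis vector `b x` by `τ ^ (wt x - m)`. -/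
noncomputable def rescale (τ : K) (m : ℕ) : Module.End K V :=
  sb.b.constr K fun y => τ ^ (sb.wt y - m) • sb.b y

lemma rescale_b (τ : K) (m : ℕ) (x) :
    sb.rescale τ m (sb.b x) = τ ^ (sb.wt x - m) • sb.b x := by
  exact sb.b.constr_basis K _ x

lemma rescale_apply (τ : K) (m : ℕ) (v : V) :
    sb.rescale τ m v = ∑ x, (sb.b.repr v x * τ ^ (sb.wt x - m)) • sb.b x := by
  conv_lhs => rw [← sb.b.sum_repr v]
  simp only [map_sum, map_smul, rescale_b, smul_smul]

lemma rescale_zero_of_mem (τ : K) (m : ℕ) {v : V} (hv : v ∈ sb.wtSub m) :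
    sb.rescale τ 0 v = τ ^ m • sb.rescale τ m v := by
  rw [rescale_apply, rescale_apply, Finset.smul_sum]
  refine Finset.sum_congr rfl fun x _ => ?_
  by_cases hx : sb.wt x < m
  · simp [hv x hx]
  · rw [smul_smul, mul_left_comm, ← pow_add, Nat.sub_zero, Nat.add_sub_cancel' (not_lt.1 hx)]

lemma rescale_at_zero_of_mem (m : ℕ) {v : V} (hv : v ∈ sb.wtSub (m + 1)) :
    sb.rescale 0 m v = 0 := by
  rw [rescale_apply]
  refine Finset.sum_eq_zero fun x _ => ?_
  by_cases hx : sb.wt x < m + 1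
  · simp [hv x hx]
  · rw [zero_pow (by omega), mul_zero, zero_smul]

lemma rescale_zero_injective {τ : K} (hτ : τ ≠ 0) {v : V} (hv : sb.rescale τ 0 v = 0) : v = 0 := by
  rw [rescale_apply] at hv
  have h := Fintype.linearIndependent_iff.1 sb.b.linearIndependent _ hv
  refine sb.b.ext_elem fun x => ?_
  simpa [hτ] using h x

variable {S : Finset ℤ} (hπ : IsGradingProj π S) (hZ : ∀ q x, Z (π q x) = π (q + 1) (Z x))
  {G : Module.End K V} (hGZ : ∀ x, G (Z x) = Z (G x))

include hπ hZ in
lemma proj_b (q : ℤ) (n : Fin (M + 1)) (i : Fin (sb.u n)) (k : Fin n) :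
    π q (sb.b ⟨n, i, k⟩) = if sb.p n i + k = q then sb.b ⟨n, i, k⟩ else 0 := by
  apply hπ.apply_of_eq
  rw [sb.b_apply, ← proj_pow hZ, sb.proj_w]

include hπ hZ in
lemma proj_rescale (τ : K) (m : ℕ) (q : ℤ) (v : V) :
    π q (sb.rescale τ m v) = sb.rescale τ m (π q v) := by
  suffices π q ∘ₗ sb.rescale τ m = sb.rescale τ m ∘ₗ π q from LinearMap.congr_fun this v
  refine sb.b.ext fun ⟨n, i, k⟩ => ?_
  rw [LinearMap.comp_apply, LinearMap.comp_apply, rescale_b, map_smul, sb.proj_b hπ hZ]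
  split_ifs
  · rw [rescale_b]
  · simp

include hGZ in
lemma exists_apply_b_sub_mem (n : Fin (M + 1)) (i : Fin (sb.u n)) :
    ∃ a : Fin (sb.u n) → K, (∀ k : Fin n,
      G (sb.b ⟨n, i, k⟩) - ∑ j, a j • sb.b ⟨n, j, k⟩ ∈ sb.wtSub (sb.wt ⟨n, i, k⟩ + 1)) ∧
      (kerSup Z (n - 1)).mkQ (G (sb.w n i)) =
        ∑ j, a j • (kerSup Z (n - 1)).mkQ (sb.w n j) := by
  have hpow : ∀ m y, G ((Z ^ m) y) = (Z ^ m) (G y) := fun m y =>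
    LinearMap.congr_fun (Commute.pow_right (LinearMap.ext hGZ : Commute G Z) m) y
  have hGw : G (sb.w n i) ∈ LinearMap.ker (Z ^ (n : ℕ)) := by
    rw [LinearMap.mem_ker, ← hpow, sb.pow_w, map_zero]
  obtain ⟨a, ha⟩ := (Submodule.mem_span_range_iff_exists_fun K).1
    ((sb.span n).ge (Submodule.mem_map_of_mem hGw))
  refine ⟨a, fun k => ?_, ha.symm⟩
  have h0 : G (sb.w n i) - ∑ j, a j • sb.w n j ∈ sb.wtSub (M - n + 1) := by
    have hk := k.isLt
    refine sb.mem_wtSub_of_mem_kerSup (n := n) (by omega) (by omega) ?_ ?_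
    · simp [LinearMap.mem_ker.1 hGw, sb.pow_w]
    · rw [← Submodule.ker_mkQ (kerSup Z (n - 1)), LinearMap.mem_ker, map_sub, ← ha]
      simp
  have h1 := sb.pow_mem_wtSub (k : ℕ) h0
  have h2 : (Z ^ (k : ℕ)) (G (sb.w n i) - ∑ j, a j • sb.w n j) =
      G (sb.b ⟨n, i, k⟩) - ∑ j, a j • sb.b ⟨n, j, k⟩ := by
    simp [sb.b_apply, hpow]
  rw [h2] at h1
  refine sb.wtSub_anti ?_ h1
  simp only [wt]
  omega

include hGZ in
lemma apply_b_mem_wtSub (x) : G (sb.b x) ∈ sb.wtSub (sb.wt x) := by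
  obtain ⟨n, i, k⟩ := x
  obtain ⟨a, ha, -⟩ := sb.exists_apply_b_sub_mem hGZ n i
  rw [← sub_add_cancel (G (sb.b ⟨n, i, k⟩)) (∑ j, a j • sb.b ⟨n, j, k⟩)]
  refine add_mem (sb.wtSub_anti (Nat.le_succ _) (ha k)) (Submodule.sum_mem _ fun j _ =>
    Submodule.smul_mem _ _ (sb.b_mem_wtSub ⟨n, j, k⟩))

/-- The degeneration of `G + Z` along the weight filtration. -/
noncomputable def degen (G : Module.End K V) (τ : K) : Module.End K V :=
  sb.b.constr K fun x => Z (sb.b x) + sb.rescale τ (sb.wt x) (G (sb.b x))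

lemma degen_b (τ : K) (x) :
    sb.degen G τ (sb.b x) = Z (sb.b x) + sb.rescale τ (sb.wt x) (G (sb.b x)) := by
  exact sb.b.constr_basis K _ x

lemma polyCurve_degen (v : V) : PolyCurve K fun τ => sb.degen G τ v := by
  have h : (fun τ => sb.degen G τ v) = fun τ => ∑ x, (Polynomial.C (sb.b.repr v x)).eval τ •
      (Z (sb.b x) + ∑ y, (Polynomial.C (sb.b.repr (G (sb.b x)) y) *
        Polynomial.X ^ (sb.wt y - sb.wt x)).eval τ • sb.b y) := by
    funext τ
    conv_lhs => rw [← sb.b.sum_repr v]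
    simp only [map_sum, map_smul, degen_b, rescale_apply, Polynomial.eval_C, Polynomial.eval_mul,
      Polynomial.eval_pow, Polynomial.eval_X]
  rw [h]
  exact PolyCurve.sum _ fun x _ => PolyCurve.eval_smul _ <| (polyCurve_const _).add <|
    PolyCurve.sum _ fun y _ => PolyCurve.eval_smul _ (polyCurve_const _)

include hGZ in
lemma rescale_pow_apply (τ : K) (N : ℕ) (v : V) :
    sb.rescale τ 0 (((τ ^ 2 • G + Z) ^ N) v) =
      (τ ^ 2) ^ N • (sb.degen G τ ^ N) (sb.rescale τ 0 v) := by
  have h1 : ∀ v, sb.rescale τ 0 ((τ ^ 2 • G + Z) v) =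
      τ ^ 2 • sb.degen G τ (sb.rescale τ 0 v) := by
    intro v
    suffices sb.rescale τ 0 ∘ₗ (τ ^ 2 • G + Z) = τ ^ 2 • sb.degen G τ ∘ₗ sb.rescale τ 0 from
      LinearMap.congr_fun this v
    refine sb.b.ext fun x => ?_
    have hZb : sb.rescale τ 0 (Z (sb.b x)) = τ ^ (sb.wt x + 2) • Z (sb.b x) := by
      obtain ⟨n, i, k⟩ := x
      rw [apply_b]
      split_ifs with h
      · rw [rescale_b]
        congr 2
        simp only [wt]
        omega
      · simp
    simp only [LinearMap.comp_apply, LinearMap.add_apply, LinearMap.smul_apply, map_add, map_smul,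
      hZb, sb.rescale_zero_of_mem τ _ (sb.apply_b_mem_wtSub hGZ x), rescale_b, degen_b,
      Nat.sub_zero]
    module
  induction N with
  | zero => simp
  | succ N ih =>
    rw [pow_succ', Module.End.mul_apply, h1, ih, map_smul, pow_succ' (sb.degen G τ),
      Module.End.mul_apply, smul_smul, pow_succ' (τ ^ 2)]

include hGZ in
lemma degen_zero_b (n : Fin (M + 1)) (i : Fin (sb.u n)) :
    ∃ a : Fin (sb.u n) → K, (∀ k : Fin n,
      sb.degen G 0 (sb.b ⟨n, i, k⟩) = Z (sb.b ⟨n, i, k⟩) + ∑ j, a j • sb.b ⟨n, j, k⟩) ∧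
      (kerSup Z (n - 1)).mkQ (G (sb.w n i)) =
        ∑ j, a j • (kerSup Z (n - 1)).mkQ (sb.w n j) := by
  obtain ⟨a, ha, ha'⟩ := sb.exists_apply_b_sub_mem hGZ n i
  refine ⟨a, fun k => ?_, ha'⟩
  have h := sb.rescale_at_zero_of_mem _ (ha k)
  rw [map_sub, sub_eq_zero] at h
  rw [degen_b, h, map_sum]
  congr 1
  refine Finset.sum_congr rfl fun j _ => ?_
  have : sb.wt ⟨n, i, k⟩ = sb.wt ⟨n, j, k⟩ := rfl
  rw [map_smul, this, rescale_b]
  simp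

/-- The `k`-th component of a vector in the strings of length `n`. -/
noncomputable def comp (n k : ℕ) : V →ₗ[K] V ⧸ kerSup Z (n - 1) :=
  sb.b.constr K fun x =>
    if (x.1 : ℕ) = n ∧ (x.2.2 : ℕ) = k then (kerSup Z (n - 1)).mkQ (sb.w x.1 x.2.1) else 0

lemma comp_b (n k : ℕ) (x) : sb.comp n k (sb.b x) =
    if (x.1 : ℕ) = n ∧ (x.2.2 : ℕ) = k then (kerSup Z (n - 1)).mkQ (sb.w x.1 x.2.1) else 0 := by
  exact sb.b.constr_basis K _ x

lemma comp_eq_sum (n : Fin (M + 1)) (k : Fin n) (v : V) :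
    sb.comp n k v = ∑ i, sb.b.repr v ⟨n, i, k⟩ • (kerSup Z (n - 1)).mkQ (sb.w n i) := by
  suffices sb.comp n k =
      ∑ i, (sb.b.coord ⟨n, i, k⟩).smulRight ((kerSup Z (n - 1)).mkQ (sb.w n i)) by
    rw [this]
    simp
  refine sb.b.ext fun ⟨m, j, l⟩ => ?_
  classical
  rw [comp_b, LinearMap.sum_apply]
  simp only [LinearMap.smulRight_apply, Module.Basis.coord_apply, Module.Basis.repr_self,
    Finsupp.single_apply, ite_smul, one_smul, zero_smul]
  split_ifs with h
  · obtain ⟨h1, h2⟩ := h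
    obtain rfl := Fin.ext h1
    obtain rfl := Fin.ext h2
    simp
  · refine (Finset.sum_eq_zero fun i _ => if_neg fun he => h ?_).symm
    obtain ⟨rfl, he⟩ := Sigma.mk.inj_iff.1 he
    simp only [heq_eq_eq, Prod.mk.injEq] at he
    exact ⟨rfl, congrArg Fin.val he.2⟩

lemma eq_zero_of_comp {v : V} (h : ∀ n : Fin (M + 1), ∀ k : Fin n, sb.comp n k v = 0) : v = 0 := by
  refine sb.b.ext_elem fun ⟨n, i, k⟩ => ?_
  have h1 := h n k
  rw [comp_eq_sum] at h1
  simpa using Fintype.linearIndependent_iff.1 (sb.indep n) _ h1 i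

lemma comp_degen_zero {n k : ℕ} (hk : k < n) (v : V) :
    sb.comp n k (sb.degen G 0 v) =
      quotMap hGZ (n - 1) (sb.comp n k v) + if k = 0 then 0 else sb.comp n (k - 1) v := by
  suffices sb.comp n k ∘ₗ sb.degen G 0 = quotMap hGZ (n - 1) ∘ₗ sb.comp n k +
      if k = 0 then 0 else sb.comp n (k - 1) by
    have := LinearMap.congr_fun this v
    rw [LinearMap.comp_apply] at this
    rw [this]
    split_ifs <;> rfl
  refine sb.b.ext fun ⟨m, i, l⟩ => ?_
  obtain ⟨a, ha, ha'⟩ := sb.degen_zero_b hGZ m i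
  rw [LinearMap.comp_apply, ha, map_add, LinearMap.add_apply, add_comm, LinearMap.comp_apply]
  congr 1
  · simp only [map_sum, map_smul, comp_b]
    by_cases h : (m : ℕ) = n ∧ (l : ℕ) = k
    · simp only [h, and_self, if_true]
      obtain ⟨rfl, -⟩ := h
      exact ha'.symm
    · simp [h]
  · rw [apply_b]
    by_cases hk0 : k = 0
    · subst hk0
      rw [if_pos rfl, LinearMap.zero_apply]
      split_ifs
      · rw [comp_b, if_neg (by simp)]
      · exact map_zero _
    · rw [if_neg hk0, comp_b]
      split_ifs with h1 h2 h2
      · rw [comp_b, if_pos]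
        simp only at h2 ⊢
        omega
      · rw [comp_b, if_neg]
        simp only at h2 ⊢
        omega
      · simp only at h2
        omega
      · exact map_zero _

lemma addShift_pow_comp {n : ℕ} (N : ℕ) {k : ℕ} (hk : k < n) (v : V) :
    (addShift (quotMap hGZ (n - 1)) ^ N) (fun k => sb.comp n k v) k =
      sb.comp n k ((sb.degen G 0 ^ N) v) := by
  induction N generalizing k with
  | zero => simp
  | succ N ih =>
    rw [pow_succ', Module.End.mul_apply, pow_succ', Module.End.mul_apply,
      sb.comp_degen_zero hGZ hk, ← ih hk, ← ih (k := k - 1) (by omega)]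
    rfl

include hπ hZ in
lemma comp_proj_mem (n k : ℕ) (q : ℤ) (v : V) :
    sb.comp n k (π q v) ∈ (LinearMap.ker (Z ^ n) ⊓ LinearMap.range (π (q - k))).map
      (kerSup Z (n - 1)).mkQ := by
  suffices v ∈ ((LinearMap.ker (Z ^ n) ⊓ LinearMap.range (π (q - k))).map
      (kerSup Z (n - 1)).mkQ).comap (sb.comp n k ∘ₗ π q) from this
  refine forall_mem_of_basis sb.b (fun ⟨m, i, l⟩ => ?_) v
  rw [Submodule.mem_comap, LinearMap.comp_apply, sb.proj_b hπ hZ]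
  split_ifs with h
  · rw [comp_b]
    split_ifs with h'
    · obtain ⟨h1, h2⟩ := h'
      simp only at h1 h2
      subst h1
      refine Submodule.mem_map_of_mem ⟨sb.pow_w _ _, hπ.mem_range_iff.2 ?_⟩
      rw [← h, h2, add_sub_cancel_right]
      exact sb.proj_w _ _
    · exact Submodule.zero_mem _
  · rw [map_zero]
    exact Submodule.zero_mem _

include hπ hZ in
/-- The degenerate operator inherits injectivity from the graded pieces `ker Z ^ n` modulo
`kerSup Z (n - 1)`. -/
lemma degen_zero_pow_injective [CharZero K] (hG : ∀ q x, G (π q x) = π (q + 1) (G x))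
    (hGZ : ∀ x, G (Z x) = Z (G x)) {c : ℤ}
    (hinj : ∀ n, 1 ≤ n → n ≤ M → ∀ (q : ℤ) (N : ℕ), 2 * q + N = c - n + 1 → ∀ y, (Z ^ n) y = 0 →
      π q y = y → (G ^ N) y ∈ kerSup Z (n - 1) → y ∈ kerSup Z (n - 1))
    {q : ℤ} {N : ℕ} (hqN : 2 * q + N = c) {v : V} (hv : π q v = v)
    (h0 : (sb.degen G 0 ^ N) v = 0) : v = 0 := by
  refine sb.eq_zero_of_comp fun n k => ?_
  have hn : 1 ≤ (n : ℕ) := k.pos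
  have hnM : (n : ℕ) ≤ M := by omega
  have hcom : ∀ y, G ((Z ^ (n : ℕ)) y) = (Z ^ (n : ℕ)) (G y) := fun y =>
    LinearMap.congr_fun (Commute.pow_right (LinearMap.ext hGZ : Commute G Z) n) y
  refine addShift_pow_injective ((n : ℕ) - 1) (quotMap hGZ ((n : ℕ) - 1))
    (fun q => (LinearMap.ker (Z ^ (n : ℕ)) ⊓ LinearMap.range (π q)).map
      (kerSup Z ((n : ℕ) - 1)).mkQ) ?_ (c - n + 1) ?_ q N ?_ (fun k => sb.comp n k v) ?_ ?_ k
      (by omega)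
  · rintro q _ ⟨y, ⟨hy1, hy2⟩, rfl⟩
    rw [SetLike.mem_coe, hπ.mem_range_iff] at hy2
    refine ⟨G y, ⟨?_, hπ.mem_range_iff.2 (by rw [← hG, hy2])⟩, rfl⟩
    rw [SetLike.mem_coe, LinearMap.mem_ker] at hy1 ⊢
    rw [← hcom, hy1, map_zero]
  · rintro q N hN _ ⟨y, ⟨hy1, hy2⟩, rfl⟩ h
    rw [SetLike.mem_coe, hπ.mem_range_iff] at hy2
    rw [quotMap_pow_mkQ, Submodule.mkQ_apply, Submodule.Quotient.mk_eq_zero] at h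
    rw [Submodule.mkQ_apply, Submodule.Quotient.mk_eq_zero]
    exact hinj n hn hnM q N hN y hy1 hy2 h
  · rw [hqN]
    push_cast [hn]
    ring
  · intro k _
    rw [← hv]
    exact sb.comp_proj_mem hπ hZ n k q v
  · intro k hk
    rw [sb.addShift_pow_comp hGZ N (by omega), h0, map_zero]

end StringBasis

/-- If `G` acts on the graded pieces of the strings of `Z` like a strong Lefschetz operator, then
so does `τ • G + Z` on `V` for some `τ`. -/
lemma exists_smul_add_pow_injective [CharZero K] [FiniteDimensional K V] {Z G : Module.End K V}
    {π : ℤ → Module.End K V} {S : Finset ℤ} (hπ : IsGradingProj π S)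
    (hZ : ∀ q x, Z (π q x) = π (q + 1) (Z x)) (hG : ∀ q x, G (π q x) = π (q + 1) (G x))
    (hGZ : ∀ x, G (Z x) = Z (G x)) {M : ℕ} (hM : Z ^ M = 0) {c : ℤ}
    (hinj : ∀ n, 1 ≤ n → n ≤ M → ∀ (q : ℤ) (N : ℕ), 2 * q + N = c - n + 1 → ∀ y, (Z ^ n) y = 0 →
      π q y = y → (G ^ N) y ∈ kerSup Z (n - 1) → y ∈ kerSup Z (n - 1)) :
    ∃ τ : K, ∀ (q : ℤ) (N : ℕ), 2 * q + N = c → ∀ v, π q v = v →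
      ((τ • G + Z) ^ N) v = 0 → v = 0 := by
  obtain ⟨sb⟩ := nonempty_stringBasis hπ hZ hM
  let F : ∀ q : ℤ, K → LinearMap.range (π q) →ₗ[K] V := fun q τ =>
    (sb.degen G τ ^ (c - 2 * q).toNat) ∘ₗ (LinearMap.range (π q)).subtype
  have hF : (⋃ q ∈ S.filter (2 * · ≤ c), {τ | ¬ Function.Injective (F q τ)}).Finite := by
    refine Set.Finite.biUnion (Finset.finite_toSet _) fun q hq => ?_
    have hqc : 2 * q ≤ c := (Finset.mem_filter.1 hq).2
    refine finite_not_injective (τ₀ := 0)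
      (fun v => polyCurve_pow_apply sb.polyCurve_degen _ (v : V)) ?_
    refine (injective_iff_map_eq_zero _).2 fun v hv => Subtype.ext ?_
    exact sb.degen_zero_pow_injective hπ hZ hG hGZ hinj (q := q) (N := (c - 2 * q).toNat)
      (by omega) (hπ.mem_range_iff.1 v.2) hv
  obtain ⟨τ, hτ⟩ := (hF.insert 0).exists_notMem
  simp only [Set.mem_insert_iff, Set.mem_iUnion, Finset.mem_filter, Set.mem_ofPred_eq, not_or,
    not_exists, not_not] at hτ
  refine ⟨τ ^ 2, fun q N hqN v hv h0 => ?_⟩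
  by_cases hq : q ∈ S
  · have hinj' := hτ.2 q ⟨hq, by omega⟩
    obtain rfl : N = (c - 2 * q).toNat := by omega
    have h1 := sb.rescale_pow_apply hGZ τ (c - 2 * q).toNat v
    rw [h0, map_zero, eq_comm, smul_eq_zero_iff_right (by simp [hτ.1])] at h1
    have hmem : sb.rescale τ 0 v ∈ LinearMap.range (π q) := by
      rw [hπ.mem_range_iff, sb.proj_rescale hπ hZ, hv]
    have h2 := (injective_iff_map_eq_zero _).1 hinj' ⟨_, hmem⟩ h1
    exact sb.rescale_zero_injective hτ.1 (congrArg Subtype.val h2)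
  · exact hπ.eq_zero_of_notMem hv hq

end Degeneration

section Symmetry

variable {K : Type} [Field K] {V : Type} [AddCommGroup V] [Module K V] [FiniteDimensional K V]
  {Z : Module.End K V} {π : ℤ → Module.End K V} {M : ℕ} {S : Finset ℤ}

lemma StringBasis.finrank_piece (sb : StringBasis Z π M) (hπ : IsGradingProj π S)
    (hZ : ∀ q x, Z (π q x) = π (q + 1) (Z x)) (n : ℕ) (q : ℤ) :
    Module.finrank K ((LinearMap.ker (Z ^ n) ⊓ LinearMap.range (π q)).map
      (kerSup Z (n - 1)).mkQ) = (Finset.univ.filter fun i => sb.p n i = q).card := by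
  refine hπ.finrank_map_inf_range (fun q x hx => ?_) (fun i => sb.pow_w n i) (sb.proj_w n)
    (sb.indep n) (sb.span n).ge q
  rw [Submodule.mkQ_apply, Submodule.Quotient.mk_eq_zero] at hx ⊢
  exact proj_mem_kerSup hZ (n - 1) q hx

lemma StringBasis.finrank_range_proj (sb : StringBasis Z π M) (hπ : IsGradingProj π S)
    (hZ : ∀ q x, Z (π q x) = π (q + 1) (Z x)) (q : ℤ) :
    Module.finrank K (LinearMap.range (π q)) =
      ∑ n : Fin (M + 1), ∑ k : Fin n, Module.finrank K
        ((LinearMap.ker (Z ^ (n : ℕ)) ⊓ LinearMap.range (π (q - k))).map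
          (kerSup Z (n - 1)).mkQ) := by
  have h := hπ.finrank_map_inf_range (T := ⊤) (f := LinearMap.id) (w := sb.b)
    (p := fun x => sb.p x.1 x.2.1 + (x.2.2 : ℕ)) (fun _ _ h => by simp_all) (by simp)
    (fun x => by rw [sb.proj_b hπ hZ, if_pos rfl]) sb.b.linearIndependent
    (by simp [sb.b.span_eq]) q
  rw [top_inf_eq, Submodule.map_id] at h
  rw [h, Finset.card_filter, Fintype.sum_sigma]
  refine Finset.sum_congr rfl fun n _ => ?_
  rw [Fintype.sum_prod_type_right]
  refine Finset.sum_congr rfl fun k _ => ?_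
  rw [sb.finrank_piece hπ hZ, Finset.card_filter]
  simp only [eq_sub_iff_add_eq]

/-- If the pieces `ker Z ^ n` modulo `kerSup Z (n - 1)` have Hilbert functions symmetric about
`(c - n + 1) / 2`, then the Hilbert function of `V` is symmetric about `c / 2`. -/
lemma finrank_range_proj_symm (hπ : IsGradingProj π S)
    (hZ : ∀ q x, Z (π q x) = π (q + 1) (Z x)) (hM : Z ^ M = 0) {c : ℤ}
    (hdim : ∀ n, 1 ≤ n → n ≤ M → ∀ q q' : ℤ, q + q' = c - n + 1 →
      Module.finrank K ((LinearMap.ker (Z ^ n) ⊓ LinearMap.range (π q)).map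
        (kerSup Z (n - 1)).mkQ) ≤
      Module.finrank K ((LinearMap.ker (Z ^ n) ⊓ LinearMap.range (π q')).map
        (kerSup Z (n - 1)).mkQ)) (q q' : ℤ) (hq : q + q' = c) :
    Module.finrank K (LinearMap.range (π q)) = Module.finrank K (LinearMap.range (π q')) := by
  obtain ⟨sb⟩ := nonempty_stringBasis hπ hZ hM
  rw [sb.finrank_range_proj hπ hZ, sb.finrank_range_proj hπ hZ]
  refine Finset.sum_congr rfl fun n _ => ?_
  rw [← Equiv.sum_comp Fin.revPerm]
  refine Finset.sum_congr rfl fun k _ => ?_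
  have hsum : (q - ((Fin.revPerm k : Fin n) : ℕ) : ℤ) + (q' - (k : ℕ)) = c - (n : ℕ) + 1 := by
    rw [Fin.revPerm_apply, Fin.val_rev]
    omega
  exact le_antisymm (hdim n k.pos (by omega) _ _ hsum)
    (hdim n k.pos (by omega) _ _ (by rw [add_comm, hsum]))

end Symmetry

section Pieces

variable {K : Type} [Field K] {V : Type} [AddCommGroup V] [Module K V]

/-- `G` acts on the graded pieces of `kerSup Z n ⧸ kerSup Z (n - 1)` like a strong Lefschetz
operator centred at `s / 2`. -/
def IsPieceSL (Z : Module.End K V) (π : ℤ → Module.End K V) (s : ℤ) (n : ℕ)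
    (G : Module.End K V) : Prop :=
  ∀ (q : ℤ) (N : ℕ), 2 * q + N = s →
    (∀ x ∈ kerSup Z n, π q x = x → (G ^ N) x ∈ kerSup Z (n - 1) → x ∈ kerSup Z (n - 1)) ∧
    (∀ y ∈ kerSup Z n, π (q + N) y = y →
      ∃ x ∈ kerSup Z n, π q x = x ∧ (G ^ N) x - y ∈ kerSup Z (n - 1))

variable {Z : Module.End K V} {π : ℤ → Module.End K V} {S : Finset ℤ}

lemma map_mkQ_kerSup_inf (hπ : IsGradingProj π S) (hZ : ∀ q x, Z (π q x) = π (q + 1) (Z x))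
    (n : ℕ) (q : ℤ) :
    (kerSup Z n ⊓ LinearMap.range (π q)).map (kerSup Z (n - 1)).mkQ =
      (LinearMap.ker (Z ^ n) ⊓ LinearMap.range (π q)).map (kerSup Z (n - 1)).mkQ := by
  refine le_antisymm ?_ (Submodule.map_mono (inf_le_inf_right _ le_sup_left))
  rintro _ ⟨x, ⟨hx, hxq⟩, rfl⟩
  rw [SetLike.mem_coe, hπ.mem_range_iff] at hxq
  obtain ⟨y, hy, t, ht, rfl⟩ := Submodule.mem_sup.1 hx
  refine ⟨π q y, ⟨proj_mem_ker_pow hZ n q hy, ⟨y, rfl⟩⟩, ?_⟩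
  rw [← sub_eq_zero, ← map_sub, Submodule.mkQ_apply, Submodule.Quotient.mk_eq_zero]
  have h : π q y - (y + t) = -π q t := by
    rw [← hxq, map_add]
    abel
  rw [h]
  exact neg_mem (proj_mem_kerSup hZ (n - 1) q (Submodule.mem_sup_right ht))

lemma IsPieceSL.finrank_eq [FiniteDimensional K V] (hπ : IsGradingProj π S)
    {G : Module.End K V} (hG : ∀ q x, G (π q x) = π (q + 1) (G x))
    (hGZ : ∀ x, G (Z x) = Z (G x)) {s : ℤ} {n : ℕ} (h : IsPieceSL Z π s n G) {q : ℤ} {N : ℕ}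
    (hqN : 2 * q + N = s) :
    Module.finrank K ((kerSup Z n ⊓ LinearMap.range (π q)).map (kerSup Z (n - 1)).mkQ) =
      Module.finrank K
        ((kerSup Z n ⊓ LinearMap.range (π (q + N))).map (kerSup Z (n - 1)).mkQ) := by
  have hpow : ∀ x ∈ kerSup Z n, (G ^ N) x ∈ kerSup Z n := by
    intro x hx
    refine mem_kerSup_of_commute (fun y => ?_) n hx
    exact LinearMap.congr_fun (Commute.pow_left (LinearMap.ext hGZ : Commute G Z) N) y
  have h1 := finrank_map_add_finrank_ker_inf (quotMap hGZ (n - 1) ^ N)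
    ((kerSup Z n ⊓ LinearMap.range (π q)).map (kerSup Z (n - 1)).mkQ)
  have h2 : LinearMap.ker (quotMap hGZ (n - 1) ^ N) ⊓
      (kerSup Z n ⊓ LinearMap.range (π q)).map (kerSup Z (n - 1)).mkQ = ⊥ := by
    rw [eq_bot_iff]
    rintro _ ⟨h0, ⟨x, ⟨hx, hxq⟩, rfl⟩⟩
    rw [SetLike.mem_coe, LinearMap.mem_ker, quotMap_pow_mkQ, Submodule.mkQ_apply,
      Submodule.Quotient.mk_eq_zero] at h0
    rw [Submodule.mem_bot, Submodule.mkQ_apply, Submodule.Quotient.mk_eq_zero]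
    exact (h q N hqN).1 x hx (hπ.mem_range_iff.1 hxq) h0
  have h3 : ((kerSup Z n ⊓ LinearMap.range (π q)).map (kerSup Z (n - 1)).mkQ).map
      (quotMap hGZ (n - 1) ^ N) =
      (kerSup Z n ⊓ LinearMap.range (π (q + N))).map (kerSup Z (n - 1)).mkQ := by
    apply le_antisymm
    · rintro _ ⟨_, ⟨x, ⟨hx, hxq⟩, rfl⟩, rfl⟩
      rw [SetLike.mem_coe, hπ.mem_range_iff] at hxq
      rw [quotMap_pow_mkQ]
      exact Submodule.mem_map_of_mem ⟨hpow x hx,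
        hπ.mem_range_iff.2 (by rw [← proj_pow hG, hxq])⟩
    · rintro _ ⟨y, ⟨hy, hyq⟩, rfl⟩
      obtain ⟨x, hx, hxq, hxy⟩ := (h q N hqN).2 y hy (hπ.mem_range_iff.1 hyq)
      refine ⟨_, Submodule.mem_map_of_mem ⟨hx, hπ.mem_range_iff.2 hxq⟩, ?_⟩
      rw [quotMap_pow_mkQ, ← sub_eq_zero, ← map_sub, Submodule.mkQ_apply,
        Submodule.Quotient.mk_eq_zero]
      exact hxy
  rw [h2, h3, finrank_bot, add_zero] at h1
  exact h1.symm

/-- The injectivity conditions of finitely many pieces can be realised simultaneously. -/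
lemma exists_forall_piece_injective [Infinite K] [FiniteDimensional K V]
    (hπ : IsGradingProj π S) {E : Type} [AddCommGroup E] [Module K E] (μ : E →ₗ[K] Module.End K V)
    (hμ : ∀ e x, μ e (Z x) = Z (μ e x)) (M : ℕ) (s : ℕ → ℤ)
    (h : ∀ n, 1 ≤ n → n ≤ M → ∃ e, IsPieceSL Z π (s n) n (μ e)) :
    ∃ e, ∀ n, 1 ≤ n → n ≤ M → ∀ (q : ℤ) (N : ℕ), 2 * q + N = s n → ∀ x ∈ kerSup Z n,
      π q x = x → (μ e ^ N) x ∈ kerSup Z (n - 1) → x ∈ kerSup Z (n - 1) := by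
  let P : ℕ × ℤ → E → Prop := fun j e => ∀ x ∈ kerSup Z j.1, π j.2 x = x →
    (μ e ^ (s j.1 - 2 * j.2).toNat) x ∈ kerSup Z (j.1 - 1) → x ∈ kerSup Z (j.1 - 1)
  have hP : ∀ j e, P j e ↔ Function.Injective ((quotMap (hμ e) (j.1 - 1) ^
      (s j.1 - 2 * j.2).toNat) ∘ₗ ((kerSup Z j.1 ⊓ LinearMap.range (π j.2)).map
        (kerSup Z (j.1 - 1)).mkQ).subtype) := by
    intro j e
    rw [injective_iff_map_eq_zero]
    constructor
    · rintro hj ⟨_, x, ⟨hx, hxq⟩, rfl⟩ h0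
      rw [SetLike.mem_coe, hπ.mem_range_iff] at hxq
      rw [LinearMap.comp_apply, Submodule.subtype_apply, quotMap_pow_mkQ, Submodule.mkQ_apply,
        Submodule.Quotient.mk_eq_zero] at h0
      exact Subtype.ext ((Submodule.Quotient.mk_eq_zero _).2 (hj x hx hxq h0))
    · intro hj x hx hxq h0
      have := hj ⟨_, Submodule.mem_map_of_mem ⟨hx, hπ.mem_range_iff.2 hxq⟩⟩ (by
        rw [LinearMap.comp_apply, Submodule.subtype_apply, quotMap_pow_mkQ, Submodule.mkQ_apply,
          Submodule.Quotient.mk_eq_zero]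
        exact h0)
      rw [← Submodule.Quotient.mk_eq_zero]
      exact congrArg Subtype.val this
  have hline : ∀ j x y, P j x → {τ : K | ¬ P j (x + τ • y)}.Finite := by
    intro j x y hj
    simp only [hP]
    rw [hP] at hj
    have hq : ∀ τ : K, quotMap (hμ (x + τ • y)) (j.1 - 1) =
        quotMap (hμ x) (j.1 - 1) + τ • quotMap (hμ y) (j.1 - 1) := by
      intro τ
      refine LinearMap.ext fun v => ?_
      obtain ⟨v, rfl⟩ := Submodule.mkQ_surjective _ v
      simp [quotMap]
    refine finite_not_injective (τ₀ := (0 : K)) (F := fun τ =>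
      (quotMap (hμ (x + τ • y)) (j.1 - 1) ^ (s j.1 - 2 * j.2).toNat) ∘ₗ
        ((kerSup Z j.1 ⊓ LinearMap.range (π j.2)).map (kerSup Z (j.1 - 1)).mkQ).subtype)
      (fun v => polyCurve_pow_apply (fun v => ?_) _ (v : V ⧸ kerSup Z (j.1 - 1))) ?_
    · simp only [hq, LinearMap.add_apply, LinearMap.smul_apply]
      refine (polyCurve_const _).add ?_
      simpa using (polyCurve_const (quotMap (hμ y) (j.1 - 1) v)).eval_smul Polynomial.X
    · simpa [hq] using hj
  obtain ⟨e, he⟩ := exists_forall_of_generic_on_lines P hline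
    ((Finset.Icc 1 M ×ˢ S).filter fun j => 2 * j.2 ≤ s j.1) (by
      rintro ⟨n, q⟩ hj
      simp only [Finset.mem_filter, Finset.mem_product, Finset.mem_Icc] at hj
      obtain ⟨e, he⟩ := h n hj.1.1.1 hj.1.1.2
      exact ⟨e, (he q (s n - 2 * q).toNat (by omega)).1⟩)
  refine ⟨e, fun n h1 hn q N hqN x hx hxq h0 => ?_⟩
  by_cases hq : q ∈ S
  · refine he (n, q) ?_ x hx hxq ?_
    · simp only [Finset.mem_filter, Finset.mem_product, Finset.mem_Icc]
      exact ⟨⟨⟨h1, hn⟩, hq⟩, by omega⟩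
    · have : (s n - 2 * q).toNat = N := by omega
      simpa only [this] using h0
  · rw [hπ.eq_zero_of_notMem hxq hq]
    exact zero_mem _

/-- A strong Lefschetz operator is obtained from strong Lefschetz operators on the pieces. -/
lemma exists_SL_of_pieces [CharZero K] [FiniteDimensional K V] (hπ : IsGradingProj π S)
    {E : Type} [AddCommGroup E] [Module K E] (μ : E →ₗ[K] Module.End K V)
    (hdeg : ∀ e q x, μ e (π q x) = π (q + 1) (μ e x)) (e₀ : E)
    (hμ : ∀ e x, μ e (μ e₀ x) = μ e₀ (μ e x)) {M : ℕ} (hM : μ e₀ ^ M = 0) {c : ℤ}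
    (h : ∀ n, 1 ≤ n → n ≤ M → ∃ e, IsPieceSL (μ e₀) π (c - n + 1) n (μ e)) :
    ∃ e, ∀ (q : ℤ) (N : ℕ), 2 * q + N = c →
      (∀ v, π q v = v → (μ e ^ N) v = 0 → v = 0) ∧
      (∀ w, π (q + N) w = w → ∃ v, π q v = v ∧ (μ e ^ N) v = w) := by
  obtain ⟨e, he⟩ := exists_forall_piece_injective hπ μ hμ M (fun n => c - n + 1) h
  obtain ⟨τ, hτ⟩ := exists_smul_add_pow_injective hπ (hdeg e₀) (hdeg e) (hμ e) hM
    (fun n h1 hn q N hqN y hy hyq h0 =>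
      he n h1 hn q N hqN y (Submodule.mem_sup_left hy) hyq h0)
  rw [← map_smul, ← map_add] at hτ
  have hdim := finrank_range_proj_symm hπ (hdeg e₀) hM (c := c) (by
    intro n h1 hn q q' hqq
    obtain ⟨e, he⟩ := h n h1 hn
    rw [← map_mkQ_kerSup_inf hπ (hdeg e₀), ← map_mkQ_kerSup_inf hπ (hdeg e₀)]
    rcases le_total q q' with hle | hle
    · obtain ⟨N, rfl⟩ := Int.le.dest hle
      exact (he.finrank_eq hπ (hdeg e) (hμ e) (by omega)).le
    · obtain ⟨N, rfl⟩ := Int.le.dest hle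
      exact (he.finrank_eq hπ (hdeg e) (hμ e) (by omega)).ge)
  refine ⟨τ • e + e₀, fun q N hqN => ⟨hτ q N hqN, fun w hw => ?_⟩⟩
  have hmaps : ∀ v ∈ LinearMap.range (π q),
      (μ (τ • e + e₀) ^ N) v ∈ LinearMap.range (π (q + N)) := by
    intro v hv
    rw [hπ.mem_range_iff] at hv ⊢
    rw [← proj_pow (hdeg _), hv]
  have hsurj := (LinearMap.injective_iff_surjective_of_finrank_eq_finrank
    (hdim q (q + N) (by omega)) (f := (μ (τ • e + e₀) ^ N).restrict hmaps)).1 (by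
      refine (injective_iff_map_eq_zero _).2 fun v hv => Subtype.ext ?_
      exact hτ q N hqN v (hπ.mem_range_iff.1 v.2) (congrArg Subtype.val hv))
  obtain ⟨v, hv⟩ := hsurj ⟨w, hπ.mem_range_iff.2 hw⟩
  exact ⟨v, hπ.mem_range_iff.1 v.2, congrArg Subtype.val hv⟩

end Pieces

section Bridge

variable {K : Type} [Field K] {V : Type} [AddCommGroup V] [Module K V]

lemma exists_isGradingProj {ℒ : ℕ → Submodule K V} (h : DirectSum.IsInternal ℒ) {c : ℕ}
    (hc : ∀ i, c < i → ℒ i = ⊥) :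
    ∃ π : ℤ → Module.End K V, IsGradingProj π (Finset.Icc 0 (c : ℤ)) ∧
      ∀ q x, π q x = x ↔ x ∈ natToZ K ℒ q := by
  classical
  let := h.chooseDecomposition
  let P : ℕ → Module.End K V := fun i =>
    (ℒ i).subtype ∘ₗ DirectSum.component K ℕ (fun i => ℒ i) i ∘ₗ
      (DirectSum.decomposeLinearEquiv ℒ).toLinearMap
  have hP : ∀ i x, P i x = DirectSum.decompose ℒ x i := fun i x => rfl
  have hmem : ∀ i x, P i x ∈ ℒ i := fun i x => (DirectSum.decompose ℒ x i).2
  have hsame : ∀ i x, x ∈ ℒ i → P i x = x := fun i x hx =>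
    DirectSum.decompose_of_mem_same ℒ hx
  have hne : ∀ i j x, x ∈ ℒ i → i ≠ j → P j x = 0 := fun i j x hx hij =>
    DirectSum.decompose_of_mem_ne ℒ hx hij
  refine ⟨fun q => if 0 ≤ q then P q.toNat else 0, ⟨?_, ?_, ?_⟩, ?_⟩
  · intro q x
    split_ifs
    · exact hsame _ _ (hmem _ _)
    · rfl
  · intro q q' x hq
    split_ifs
    · exact hne _ _ _ (hmem _ _) (by omega)
    · simp
    · simp
    · simp
  · intro x
    have h1 : ∑ i ∈ Finset.range (c + 1), P i x = x := by
      conv_rhs => rw [← DirectSum.sum_support_decompose ℒ x]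
      symm
      apply Finset.sum_subset
      · intro i hi
        rw [Finset.mem_range]
        by_contra hci
        rw [DFinsupp.mem_support_iff] at hi
        apply hi
        have := hmem i x
        rw [hc i (by omega), Submodule.mem_bot] at this
        exact Subtype.ext this
      · intro i _ hi
        rw [DFinsupp.notMem_support_iff] at hi
        rw [hi]
        rfl
    refine Eq.trans ?_ h1
    refine Finset.sum_bij' (fun q _ => q.toNat) (fun i _ => (i : ℤ)) ?_ ?_ ?_ ?_ ?_
    · intro q hq
      rw [Finset.mem_Icc] at hq
      rw [Finset.mem_range]
      omega
    · intro i hi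
      rw [Finset.mem_range] at hi
      rw [Finset.mem_Icc]
      omega
    · intro q hq
      rw [Finset.mem_Icc] at hq
      simp [hq.1]
    · intro i _
      simp
    · intro q hq
      rw [Finset.mem_Icc] at hq
      simp [hq.1]
  · intro q x
    dsimp only [natToZ]
    split_ifs
    · exact ⟨fun hx => hx ▸ hmem _ _, hsame _ _⟩
    · rw [Submodule.mem_bot]
      exact eq_comm

lemma IsGradingProj.map_proj {π : ℤ → Module.End K V} {S : Finset ℤ} (h : IsGradingProj π S)
    {G : Module.End K V} (hG : ∀ q x, π q x = x → π (q + 1) (G x) = G x) (q : ℤ) (x : V) :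
    G (π q x) = π (q + 1) (G x) := by
  conv_rhs => rw [← h.sum x, map_sum, map_sum]
  have h1 : ∀ q' ∈ S, π (q + 1) (G (π q' x)) = if q' = q then G (π q x) else 0 := by
    intro q' _
    rw [h.apply_of_eq (hG q' _ (h.idem q' x))]
    by_cases hq : q' = q
    · simp [hq]
    · simp [hq]
  rw [Finset.sum_congr rfl h1, Finset.sum_ite_eq']
  split_ifs with hq
  · rfl
  · rw [h.eq_zero_of_notMem (h.idem q x) hq, map_zero]

lemma mulMap_apply {A : Type} [CommRing A] [Algebra K A] [Module A V] [IsScalarTower K A V]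
    (g : A) (v : V) : mulMap K V g v = g • v := rfl

lemma mulMap_pow_apply {A : Type} [CommRing A] [Algebra K A] [Module A V] [IsScalarTower K A V]
    (g : A) (m : ℕ) (v : V) : (mulMap K V g ^ m) v = g ^ m • v := by
  induction m with
  | zero => simp
  | succ m ih => rw [pow_succ', Module.End.mul_apply, ih, mulMap_apply, smul_smul, pow_succ']

/-- Multiplication by the elements of a subspace of `A`. -/
noncomputable def mulHom (K : Type) [Field K] {A : Type} [CommRing A] [Algebra K A]
    (E : Submodule K A) : E →ₗ[K] Module.End K A where
  toFun e := mulMap K A (e : A)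
  map_add' _ _ := LinearMap.ext fun _ => add_mul _ _ _
  map_smul' _ _ := LinearMap.ext fun _ => smul_mul_assoc _ _ _

variable {A : Type} [CommRing A] [Algebra K A]

lemma mem_colonPlus_iff (z : A) (m : ℕ) (x : A) :
    x ∈ colonPlus K z m ↔ x ∈ kerSup (mulMap K A z) m := by
  simp only [colonPlus, kerSup, Submodule.mem_sup, LinearMap.mem_ker, LinearMap.mem_range,
    mulMap_pow_apply, Ideal.mem_span_singleton', mulMap_apply, LinearMap.lsmul_apply, smul_eq_mul]
  constructor
  · rintro ⟨y, hy, _, ⟨w, rfl⟩, rfl⟩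
    exact ⟨y, hy, _, ⟨w, mul_comm _ _⟩, rfl⟩
  · rintro ⟨y, hy, _, ⟨w, rfl⟩, rfl⟩
    exact ⟨y, hy, _, ⟨w, mul_comm _ _⟩, rfl⟩

/-- The class in the central simple module of an element of `(0 : z ^ m) + zA`. -/
noncomputable def csMk (K : Type) [Field K] {A : Type} [CommRing A] [Algebra K A] (z : A)
    (m m' : ℕ) :
    colonPlus K z m →ₗ[A] CSMod K z m m' :=
  (Submodule.comap (colonPlus K z m).subtype (colonPlus K z m')).mkQ

lemma csMk_eq_zero_iff (z : A) (m m' : ℕ) (x : colonPlus K z m) :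
    csMk K z m m' x = 0 ↔ (x : A) ∈ kerSup (mulMap K A z) m' := by
  rw [csMk, ← LinearMap.mem_ker, Submodule.ker_mkQ, ← mem_colonPlus_iff]
  rfl

lemma mem_natToZ_csGrading_iff {𝒜 : ℕ → Submodule K A} {z : A} {m m' : ℕ} {q : ℤ}
    {v : CSMod K z m m'} :
    v ∈ natToZ K (csGrading K 𝒜 z m m') q ↔
      ∃ x : colonPlus K z m, (x : A) ∈ natToZ K 𝒜 q ∧ csMk K z m m' x = v := by
  unfold natToZ
  split_ifs
  · rfl
  · constructor
    · intro hv
      have hv' : v = 0 := (Submodule.mem_bot K).1 hv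
      exact ⟨0, Submodule.zero_mem _, (map_zero (csMk K z m m')).trans hv'.symm⟩
    · rintro ⟨x, hx, rfl⟩
      have h0 : x = 0 := Subtype.ext ((Submodule.mem_bot K).1 hx)
      exact (Submodule.mem_bot K).2 ((congrArg (csMk K z m m') h0).trans (map_zero _))

end Bridge

section Tensor

variable {K : Type} [Field K] {V W : Type} [AddCommGroup V] [Module K V] [AddCommGroup W]
  [Module K W]

lemma finrank_range_map_subtype [FiniteDimensional K V] [FiniteDimensional K W]
    (P : Submodule K V) (Q : Submodule K W) :
    Module.finrank K (LinearMap.range (TensorProduct.map P.subtype Q.subtype)) =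
      Module.finrank K P * Module.finrank K Q := by
  rw [LinearMap.finrank_range_of_inj, Module.finrank_tensorProduct]
  exact TensorProduct.map_injective_of_flat_flat _ _ P.injective_subtype Q.injective_subtype

lemma range_map_subtype_eq_bot_iff [FiniteDimensional K V] [FiniteDimensional K W]
    (P : Submodule K V) (Q : Submodule K W) :
    LinearMap.range (TensorProduct.map P.subtype Q.subtype) = ⊥ ↔ P = ⊥ ∨ Q = ⊥ := by
  rw [← Submodule.finrank_eq_zero, finrank_range_map_subtype, mul_eq_zero,
    Submodule.finrank_eq_zero, Submodule.finrank_eq_zero]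

instance finiteDimensional_truncPoly (n : ℕ) : FiniteDimensional K (TruncPoly K n) :=
  (Polynomial.monic_X_pow n).finite_quotient

lemma tbar_pow_ne_zero {n j : ℕ} (h : j < n) : tbar K n ^ j ≠ 0 := by
  rw [tbar, ← map_pow, Ne, Ideal.Quotient.eq_zero_iff_mem, Ideal.mem_span_singleton,
    Polynomial.X_pow_dvd_iff]
  intro h1
  simpa using h1 j h

lemma truncGrading_eq_bot_iff (n : ℕ) (j : ℤ) :
    truncGrading K n j = ⊥ ↔ ¬ (0 ≤ j ∧ j < n) := by
  unfold truncGrading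
  split_ifs with h
  · simp only [h, Submodule.span_singleton_eq_bot, and_self, not_true, iff_false]
    exact tbar_pow_ne_zero (by omega)
  · simpa using h

lemma finrank_truncGrading (n : ℕ) (j : ℤ) :
    Module.finrank K (truncGrading K n j) = if 0 ≤ j ∧ j < n then 1 else 0 := by
  unfold truncGrading
  by_cases h : 0 ≤ j ∧ j < n
  · rw [if_pos h, if_pos h]
    exact finrank_span_singleton (tbar_pow_ne_zero (by omega))
  · rw [if_neg h, if_neg h]
    exact finrank_bot K _

lemma tensorGrading_eq_bot_iff [FiniteDimensional K V] [FiniteDimensional K W]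
    (ℳ : ℤ → Submodule K V) (𝒩 : ℤ → Submodule K W) (k : ℤ) :
    tensorGrading K ℳ 𝒩 k = ⊥ ↔ ∀ i, ℳ i = ⊥ ∨ 𝒩 (k - i) = ⊥ := by
  simp only [tensorGrading, iSup_eq_bot, range_map_subtype_eq_bot_iff]

lemma tensorGrading_of_concentrated (ℳ : ℤ → Submodule K V) (𝒩 : ℤ → Submodule K W) {p : ℤ}
    (hp : ∀ i, i ≠ p → ℳ i = ⊥) (k : ℤ) :
    tensorGrading K ℳ 𝒩 k =
      LinearMap.range (TensorProduct.map (ℳ p).subtype (𝒩 (k - p)).subtype) := by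
  refine le_antisymm (iSup_le fun i => ?_) (le_iSup (fun i => LinearMap.range
    (TensorProduct.map (ℳ i).subtype (𝒩 (k - i)).subtype)) p)
  by_cases hi : i = p
  · rw [hi]
  · have : (ℳ i).subtype = 0 := by
      ext x
      exact (Submodule.mem_bot K).1 ((hp i hi).le x.2)
    rw [this, TensorProduct.map_zero_left, LinearMap.range_zero]
    exact bot_le

lemma GradedBetween.tensor_truncGrading [FiniteDimensional K V] {ℒ : ℤ → Submodule K V} {a b : ℤ}
    (h : GradedBetween K ℒ a b) {n : ℕ} (hn : 1 ≤ n) :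
    GradedBetween K (tensorGrading K ℒ (truncGrading K n)) a (b + n - 1) := by
  obtain ⟨hab, ha, hb, hl⟩ := h
  refine ⟨by omega, ?_, ?_, ?_⟩
  · rw [Ne, tensorGrading_eq_bot_iff]
    intro h
    refine (h a).elim ha fun h => ?_
    rw [truncGrading_eq_bot_iff] at h
    omega
  · rw [Ne, tensorGrading_eq_bot_iff]
    intro h
    refine (h b).elim hb fun h => ?_
    rw [truncGrading_eq_bot_iff] at h
    omega
  · intro k hk
    rw [tensorGrading_eq_bot_iff]
    intro i
    by_cases hi : i < a ∨ b < i
    · exact Or.inl (hl i hi)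
    · right
      rw [truncGrading_eq_bot_iff]
      omega

lemma GradedBetween.unique {ℒ : ℤ → Submodule K V} {a b a' b' : ℤ} (h : GradedBetween K ℒ a b)
    (h' : GradedBetween K ℒ a' b') : a = a' ∧ b = b' := by
  obtain ⟨hab, ha, hb, hl⟩ := h
  obtain ⟨hab', ha', hb', hl'⟩ := h'
  have h1 : ¬ (a < a' ∨ b' < a) := fun h => ha (hl' _ h)
  have h2 : ¬ (b < a' ∨ b' < b) := fun h => hb (hl' _ h)
  have h3 : ¬ (a' < a ∨ b < a') := fun h => ha' (hl _ h)
  have h4 : ¬ (b' < a ∨ b < b') := fun h => hb' (hl _ h)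
  omega

end Tensor

section Bounds

variable {K : Type} [Field K] {V : Type} [AddCommGroup V] [Module K V]

lemma IsSLEndo.bijective {ℒ : ℤ → Submodule K V} {a b : ℤ} (h : GradedBetween K ℒ a b)
    {f : Module.End K V} (hf : IsSLEndo K ℒ a b f) {q : ℤ} {N : ℕ} (hq : 2 * q + N = a + b) :
    (∀ v ∈ ℒ q, (f ^ N) v = 0 → v = 0) ∧ ∀ w ∈ ℒ (q + N), ∃ v ∈ ℒ q, (f ^ N) v = w := by
  by_cases hqa : q < a
  · rw [h.2.2.2 q (Or.inl hqa), h.2.2.2 (q + N) (Or.inr (by omega))]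
    refine ⟨fun v hv _ => (Submodule.mem_bot K).1 hv, fun w hw => ⟨0, Submodule.zero_mem _, ?_⟩⟩
    rw [map_zero, (Submodule.mem_bot K).1 hw]
  · have h1 := hf (q - a).toNat (by omega)
    have e1 : a + ((q - a).toNat : ℤ) = q := by omega
    have e2 : b - ((q - a).toNat : ℤ) = q + N := by omega
    have e3 : (b - a - 2 * ((q - a).toNat : ℤ)).toNat = N := by omega
    rwa [e1, e2, e3] at h1

lemma isSLEndo_self (ℒ : ℤ → Submodule K V) (p : ℤ) (f : Module.End K V) :
    IsSLEndo K ℒ p p f := by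
  intro i hi
  obtain rfl : i = 0 := by omega
  simp

lemma symAround_tensor_of_concentrated [FiniteDimensional K V] {ℒ : ℤ → Submodule K V} {p : ℤ}
    (hne : ℒ p ≠ ⊥) (hp : ∀ i, i ≠ p → ℒ i = ⊥) {n : ℕ} (hn : 1 ≤ n) {c : ℤ}
    (hc : 2 * p + n - 1 = c) : SymAround K (tensorGrading K ℒ (truncGrading K n)) c := by
  have h : GradedBetween K ℒ p p := ⟨le_rfl, hne, hne, fun i hi => hp i (by omega)⟩
  refine ⟨p, p + n - 1, h.tensor_truncGrading hn, by omega, fun j => ?_⟩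
  unfold hilb
  rw [tensorGrading_of_concentrated ℒ _ hp, tensorGrading_of_concentrated ℒ _ hp,
    finrank_range_map_subtype, finrank_range_map_subtype, finrank_truncGrading,
    finrank_truncGrading]
  congr 1
  exact if_congr (by omega) rfl rfl

end Bounds

section Algebra

variable {K A : Type} [Field K] [CommRing A] [Algebra K A] {𝒜 : ℕ → Submodule K A} {c : ℕ}
  {π : ℤ → Module.End K A} {S : Finset ℤ}

lemma IsGradedArtinAlg.mul_mem_natToZ (hA : IsGradedArtinAlg K 𝒜) {e : A} (he : e ∈ 𝒜 1) {q : ℤ}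
    {x : A} (hx : x ∈ natToZ K 𝒜 q) : e * x ∈ natToZ K 𝒜 (q + 1) := by
  unfold natToZ at hx
  split_ifs at hx with hq
  · rw [natToZ, if_pos (by omega), show (q + 1).toNat = 1 + q.toNat by omega]
    exact hA.2.2.1 _ _ e he x hx
  · rw [(Submodule.mem_bot K).1 hx, mul_zero]
    exact Submodule.zero_mem _

lemma IsGradedArtinAlg.pow_mem (hA : IsGradedArtinAlg K 𝒜) {z : A} (hz : z ∈ 𝒜 1) (m : ℕ) :
    z ^ m ∈ 𝒜 m := by
  induction m with
  | zero => rw [pow_zero]; exact hA.2.1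
  | succ m ih => rw [pow_succ]; exact hA.2.2.1 _ _ _ ih _ hz

lemma IsGradedArtinAlg.mulMap_pow_eq_zero (hA : IsGradedArtinAlg K 𝒜) (htop : GradedTop K 𝒜 c)
    {z : A} (hz : z ∈ 𝒜 1) : mulMap K A z ^ (c + 1) = 0 := by
  have h := hA.pow_mem hz (c + 1)
  rw [htop.2 _ (Nat.lt_succ_self c), Submodule.mem_bot] at h
  ext x
  rw [mulMap_pow_apply, h, zero_smul, LinearMap.zero_apply]

lemma IsGradedArtinAlg.mulMap_proj (hA : IsGradedArtinAlg K 𝒜) (hπ : IsGradingProj π S)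
    (hmem : ∀ q x, π q x = x ↔ x ∈ natToZ K 𝒜 q) {e : A} (he : e ∈ 𝒜 1) (q : ℤ) (x : A) :
    mulMap K A e (π q x) = π (q + 1) (mulMap K A e x) :=
  hπ.map_proj (fun q x hx => (hmem _ _).2 (hA.mul_mem_natToZ he ((hmem q x).1 hx))) q x

lemma isAlgSLElem_iff (htop : GradedTop K 𝒜 c) (hmem : ∀ q x, π q x = x ↔ x ∈ natToZ K 𝒜 q)
    (g : A) : IsAlgSLElem K 𝒜 c g ↔ g ∈ 𝒜 1 ∧ ∀ (q : ℤ) (N : ℕ), 2 * q + N = c →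
      (∀ v, π q v = v → (mulMap K A g ^ N) v = 0 → v = 0) ∧
      ∀ w, π (q + N) w = w → ∃ v, π q v = v ∧ (mulMap K A g ^ N) v = w := by
  refine and_congr_right fun _ => ?_
  simp only [hmem, mulMap_pow_apply, smul_eq_mul]
  constructor
  · intro h q N hq
    by_cases h0 : 0 ≤ q
    · obtain ⟨i, rfl⟩ := Int.eq_ofNat_of_zero_le h0
      have h1 := h i (by omega)
      rw [show c - 2 * i = N by omega] at h1
      simp only [natToZ]
      rw [if_pos (by omega), if_pos (by omega), Int.toNat_natCast,
        show ((i : ℤ) + N).toNat = c - i by omega]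
      exact h1
    · simp only [natToZ]
      rw [if_neg h0, if_pos (by omega), htop.2 _ (by omega)]
      simp only [Submodule.mem_bot]
      refine ⟨fun v hv _ => hv, fun w hw => ⟨0, rfl, ?_⟩⟩
      rw [mul_zero, hw]
  · intro h i hi
    have h1 := h i (c - 2 * i) (by omega)
    simp only [natToZ] at h1
    rw [if_pos (by omega), if_pos (by omega), Int.toNat_natCast,
      show ((i : ℤ) + (c - 2 * i : ℕ)).toNat = c - i by omega] at h1
    exact h1

lemma isPieceSL_of_isSLEndo (hmem : ∀ q x, π q x = x ↔ x ∈ natToZ K 𝒜 q) {z g : A} {n n' : ℕ}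
    (hn : kerSup (mulMap K A z) n' = kerSup (mulMap K A z) (n - 1)) {a b s : ℤ} (hs : a + b = s)
    (h : GradedBetween K (natToZ K (csGrading K 𝒜 z n n')) a b)
    (hg : IsSLEndo K (natToZ K (csGrading K 𝒜 z n n')) a b (mulMap K (CSMod K z n n') g)) :
    IsPieceSL (mulMap K A z) π s n (mulMap K A g) := by
  have hmk : ∀ (N : ℕ) (x : colonPlus K z n),
      (mulMap K (CSMod K z n n') g ^ N) (csMk K z n n' x) = csMk K z n n' (g ^ N • x) := by
    intro N x
    rw [mulMap_pow_apply, map_smul]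
  intro q N hq
  obtain ⟨hinj, hsurj⟩ := IsSLEndo.bijective h hg (hq.trans hs.symm)
  constructor
  · intro x hx hqx hgx
    have h0 := hinj (csMk K z n n' ⟨x, (mem_colonPlus_iff z n x).2 hx⟩)
      (mem_natToZ_csGrading_iff.2 ⟨_, (hmem q x).1 hqx, rfl⟩)
    rw [hmk, csMk_eq_zero_iff, csMk_eq_zero_iff, hn] at h0
    refine h0 ?_
    rwa [mulMap_pow_apply] at hgx
  · intro y hy hqy
    obtain ⟨v, hv, hvy⟩ := hsurj (csMk K z n n' ⟨y, (mem_colonPlus_iff z n y).2 hy⟩)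
      (mem_natToZ_csGrading_iff.2 ⟨_, (hmem _ y).1 hqy, rfl⟩)
    obtain ⟨x, hx, rfl⟩ := mem_natToZ_csGrading_iff.1 hv
    rw [hmk, ← sub_eq_zero, ← map_sub, csMk_eq_zero_iff, hn] at hvy
    refine ⟨x, (mem_colonPlus_iff z n _).1 x.2, (hmem q _).2 hx, ?_⟩
    rw [mulMap_pow_apply]
    exact hvy

lemma two_mul_add_eq_of_SL {V : Type} [AddCommGroup V] [Module K V] {Z : Module.End K V}
    {π : ℤ → Module.End K V} (hπ : IsGradingProj π S)
    (hZ : ∀ q x, Z (π q x) = π (q + 1) (Z x)) {c : ℤ}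
    (h : ∀ (q : ℤ) (N : ℕ), 2 * q + N = c → (∀ v, π q v = v → (Z ^ N) v = 0 → v = 0) ∧
      ∀ w, π (q + N) w = w → ∃ v, π q v = v ∧ (Z ^ N) v = w)
    {n : ℕ} (hn : 1 ≤ n) {q : ℤ} {x : V} (hx : x ∈ kerSup Z n) (hqx : π q x = x)
    (hx' : x ∉ kerSup Z (n - 1)) : 2 * q + n - 1 = c := by
  obtain ⟨y, hy, _, ⟨v, rfl⟩, hyx⟩ := Submodule.mem_sup.1 hx
  have hpow : ∀ N : ℕ, ∀ u, Z ((Z ^ N) u) = (Z ^ (N + 1)) u := fun N u => by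
    rw [pow_succ', Module.End.mul_apply]
  have hrange : ∀ u, Z u ∈ kerSup Z (n - 1) := fun u => Submodule.mem_sup_right ⟨u, rfl⟩
  have hy1 : π q y ∉ kerSup Z (n - 1) := by
    intro h1
    apply hx'
    rw [← hqx, ← hyx, map_add]
    refine add_mem h1 ?_
    rw [← sub_add_cancel q 1, ← hZ]
    exact hrange _
  have hy2 : (Z ^ n) (π q y) = 0 := LinearMap.mem_ker.1 (proj_mem_ker_pow hZ n q hy)
  have hker : ∀ u, (Z ^ (n - 1)) u = 0 → u ∈ kerSup Z (n - 1) := fun u hu =>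
    Submodule.mem_sup_left (LinearMap.mem_ker.2 hu)
  by_contra hne
  apply hy1
  rcases lt_or_ge c (2 * q) with hlt | hle
  · obtain ⟨N, hN⟩ := Int.eq_ofNat_of_zero_le (show 0 ≤ 2 * q - c - 1 by omega)
    obtain ⟨u, -, hu⟩ := (h (c - q) (N + 1) (by push_cast; omega)).2 (π q y) (by
      rw [show c - q + ((N + 1 : ℕ) : ℤ) = q by push_cast; omega, hπ.idem])
    rw [← hu, ← hpow]
    exact hrange _
  · obtain ⟨N, hN⟩ := Int.eq_ofNat_of_zero_le (show 0 ≤ c - 2 * q by omega)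
    by_cases hnN : n ≤ N
    · have h0 : π q y = 0 := by
        refine (h q N (by omega)).1 _ (hπ.idem q y) ?_
        rw [← Nat.sub_add_cancel hnN, pow_add, Module.End.mul_apply, hy2, map_zero]
      rw [h0]
      exact Submodule.zero_mem _
    · obtain ⟨u, -, hu⟩ := (h (q - 1) (N + 2) (by push_cast; omega)).2
        ((Z ^ (N + 1)) (π q y)) (by
          rw [proj_pow hZ, show q - 1 + ((N + 2 : ℕ) : ℤ) = q + (N + 1 : ℕ) by push_cast; ring,
            hπ.idem])
      rw [← sub_add_cancel (π q y) (Z u)]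
      refine add_mem (hker _ ?_) (hrange u)
      obtain ⟨k, hk⟩ := Nat.exists_eq_add_of_le (show N + 1 ≤ n - 1 by omega)
      rw [hk, add_comm, pow_add, Module.End.mul_apply, map_sub, ← hu, ← Module.End.mul_apply,
        ← pow_succ, sub_self, map_zero]

lemma exists_csGrading_concentrated (hA : IsGradedArtinAlg K 𝒜) (hπ : IsGradingProj π S)
    (hmem : ∀ q x, π q x = x ↔ x ∈ natToZ K 𝒜 q) {z : A} (hz : z ∈ 𝒜 1) {C : ℤ}
    (h : ∀ (q : ℤ) (N : ℕ), 2 * q + N = C →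
      (∀ v, π q v = v → (mulMap K A z ^ N) v = 0 → v = 0) ∧
      ∀ w, π (q + N) w = w → ∃ v, π q v = v ∧ (mulMap K A z ^ N) v = w)
    {n n' : ℕ} (hn : 1 ≤ n) (hn' : kerSup (mulMap K A z) n' = kerSup (mulMap K A z) (n - 1))
    (hne : kerSup (mulMap K A z) n ≠ kerSup (mulMap K A z) (n - 1)) :
    ∃ p : ℤ, 2 * p + n - 1 = C ∧ natToZ K (csGrading K 𝒜 z n n') p ≠ ⊥ ∧
      ∀ i, i ≠ p → natToZ K (csGrading K 𝒜 z n n') i = ⊥ := by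
  have hZ := fun q x => hA.mulMap_proj hπ hmem hz q x
  have hle : kerSup (mulMap K A z) (n - 1) ≤ kerSup (mulMap K A z) n :=
    ker_pow_sup_range_mono _ (Nat.sub_le n 1)
  obtain ⟨x, hx, p, hp⟩ : ∃ x ∈ kerSup (mulMap K A z) n, ∃ p,
      π p x ∉ kerSup (mulMap K A z) (n - 1) := by
    by_contra! hcon
    refine hne (le_antisymm (fun x hx => ?_) hle)
    rw [← hπ.sum x]
    exact Submodule.sum_mem _ fun q _ => hcon x hx q
  have hpx := proj_mem_kerSup hZ n p hx
  have hpc := two_mul_add_eq_of_SL hπ hZ h hn hpx (hπ.idem p x) hp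
  refine ⟨p, hpc, ?_, ?_⟩
  · rw [Submodule.ne_bot_iff]
    refine ⟨csMk K z n n' ⟨π p x, (mem_colonPlus_iff z n _).2 hpx⟩,
      mem_natToZ_csGrading_iff.2 ⟨_, (hmem p _).1 (hπ.idem p x), rfl⟩, ?_⟩
    rw [Ne, csMk_eq_zero_iff, hn']
    exact hp
  · intro i hi
    rw [Submodule.eq_bot_iff]
    intro v hv
    obtain ⟨y, hy, rfl⟩ := mem_natToZ_csGrading_iff.1 hv
    rw [csMk_eq_zero_iff, hn']
    by_contra hy'
    have := two_mul_add_eq_of_SL hπ hZ h hn ((mem_colonPlus_iff z n _).1 y.2)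
      ((hmem i _).2 hy) hy'
    omega

end Algebra

/-- Theorem 5.2. Let `K` be a field of characteristic zero and
`A = ⊕_{i=0}^{c} A_i` a graded Artinian `K`-algebra.  TFAE:
(i) `A` has the SLP;
(ii) there is a linear form `z ∈ A₁` such that every central simple module
`U_i` of `(A, z)` has the SLP and the Hilbert function of
`Ũ_i = U_i ⊗_K K[t]/(t^{f_i})` is symmetric with reflecting degree `c/2`. -/
theorem statement_8 {K A : Type} [Field K] [CharZero K] [CommRing A] [Algebra K A]
    (𝒜 : ℕ → Submodule K A) (c : ℕ)
    (hA : IsGradedArtinAlg K 𝒜) (htop : GradedTop K 𝒜 c) :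
    (∃ g : A, IsAlgSLElem K 𝒜 c g) ↔
      (∃ z ∈ 𝒜 1, ∀ d : Multiset ℕ, IsJordanType K (mulMap K A z) d →
        ∀ (s : ℕ) (f : Fin s → ℕ), DistinctSizes d f →
          ∀ i : Fin s,
            PiecesHasSLP K 𝒜
              (natToZ K (csGrading K 𝒜 z (f i) (nextSize f i))) ∧
            SymAround K
              (tensorGrading K (natToZ K (csGrading K 𝒜 z (f i) (nextSize f i)))
                (truncGrading K (f i)))
              (c : ℤ)) := by
  have : FiniteDimensional K A := hA.2.2.2.2
  obtain ⟨π, hπ, hmem⟩ := exists_isGradingProj hA.1 htop.2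
  simp only [isAlgSLElem_iff htop hmem]
  constructor
  · rintro ⟨g, hg, hSL⟩
    refine ⟨g, hg, fun d hd s f hf i => ?_⟩
    have hi : f i ∈ d := (hf.2 _).1 ⟨i, rfl⟩
    have hpos : 1 ≤ f i := hd.1 _ hi
    have hne := (hd.mem_iff (f i - 1)).1 (by rwa [Nat.sub_add_cancel hpos])
    rw [Nat.sub_add_cancel hpos] at hne
    obtain ⟨p, hpc, hp, hconc⟩ := exists_csGrading_concentrated hA hπ hmem hg hSL hpos
      (hd.ker_sup_range_nextSize hf i) hne
    exact ⟨⟨p, p, ⟨le_rfl, hp, hp, fun j hj => hconc j (by omega)⟩, g, hg, isSLEndo_self _ p _⟩,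
      symAround_tensor_of_concentrated hp hconc hpos hpc⟩
  · rintro ⟨z, hz, H⟩
    have hM := hA.mulMap_pow_eq_zero htop hz
    obtain ⟨d, hd⟩ := exists_isJordanType hM
    obtain ⟨s, f, hf⟩ := exists_distinctSizes d
    obtain ⟨e, he⟩ := exists_SL_of_pieces hπ (mulHom K (𝒜 1))
      (fun e q x => hA.mulMap_proj hπ hmem e.2 q x) ⟨z, hz⟩
      (fun e x => mul_left_comm (e : A) z x) hM (c := c) (by
        intro n hn _
        by_cases hnd : n ∈ d
        · obtain ⟨i, rfl⟩ := (hf.2 n).2 hnd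
          obtain ⟨⟨a, b, hab, g, hg, hSL⟩, a', b', hab', hsum, -⟩ := H d hd s f hf i
          have hu := hab'.unique (hab.tensor_truncGrading hn)
          exact ⟨⟨g, hg⟩, isPieceSL_of_isSLEndo hmem (hd.ker_sup_range_nextSize hf i)
            (by omega) hab hSL⟩
        · have heq : kerSup (mulMap K A z) n = kerSup (mulMap K A z) (n - 1) := by
            by_contra hne
            refine hnd ?_
            have := (hd.mem_iff (n - 1)).2 (by rwa [Nat.sub_add_cancel hn])
            rwa [Nat.sub_add_cancel hn] at this
          refine ⟨0, fun q N _ => ⟨fun x hx _ _ => heq ▸ hx, fun y hy _ => ⟨0, ?_, ?_, ?_⟩⟩⟩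
          · exact Submodule.zero_mem _
          · exact map_zero _
          · rw [map_zero, zero_sub]
            exact Submodule.neg_mem _ (heq ▸ hy))
    exact ⟨e, e.2, he⟩
end

section
/- Let K be any field and A = ⊕_{i=0}^{c} A_i a graded Artinian Gorenstein K-algebra with A_c ≠ 0, and let z ∈ A_1 be a linear form. Then for every i with 1 ≤ i ≤ s, the central simple module U_i of (A, z) has a symmetric Hilbert function, and Ũ_i = U_i ⊗_K K[t]/(t^{f_i}) has a symmetric Hilbert function whose reflecting degree equals c/2 (the reflecting degree of the Hilbert function of A). -/
set_option maxHeartbeats 1000000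
set_option synthInstance.maxHeartbeats 400000

open TensorProduct

theorem Module.End.finrank_range_inf_ker_pow {K V : Type*} [Field K] [AddCommGroup V] [Module K V]
    [FiniteDimensional K V] (L : Module.End K V) (k : ℕ) :
    Module.finrank K ↥(LinearMap.range L ⊓ LinearMap.ker (L ^ k)) +
      Module.finrank K (LinearMap.ker L) = Module.finrank K (LinearMap.ker (L ^ (k + 1))) := by
  have hle : LinearMap.ker L ≤ LinearMap.ker (L ^ (k + 1)) := by
    intro x hx
    simp only [LinearMap.mem_ker] at hx ⊢
    rw [pow_succ, Module.End.mul_apply, hx, map_zero]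
  have hmap : (LinearMap.ker (L ^ (k + 1))).map L =
      LinearMap.range L ⊓ LinearMap.ker (L ^ k) := by
    ext y
    simp only [Submodule.mem_map, LinearMap.mem_ker, Submodule.mem_inf, LinearMap.mem_range]
    constructor
    · rintro ⟨x, hx, rfl⟩
      exact ⟨⟨x, rfl⟩, by rwa [pow_succ, Module.End.mul_apply] at hx⟩
    · rintro ⟨⟨x, rfl⟩, hx⟩
      exact ⟨x, by rwa [pow_succ, Module.End.mul_apply], rfl⟩
  have h := LinearMap.finrank_range_add_finrank_ker
    (L.domRestrict (LinearMap.ker (L ^ (k + 1))))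
  rw [LinearMap.range_domRestrict, hmap, LinearMap.ker_domRestrict] at h
  rw [← h]
  congr 1
  exact (Submodule.comapSubtypeEquivOfLe hle).finrank_eq.symm

theorem Module.End.finrank_range_inf_ker_pow_sup {K V : Type*} [Field K] [AddCommGroup V]
    [Module K V] [FiniteDimensional K V] (L : Module.End K V) (k : ℕ) :
    Module.finrank K ↥((LinearMap.range L ⊓ LinearMap.ker (L ^ (k + 1))) ⊔ LinearMap.ker (L ^ k)) +
      Module.finrank K (LinearMap.ker (L ^ (k + 1))) =
    Module.finrank K (LinearMap.ker (L ^ (k + 2))) +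
      Module.finrank K (LinearMap.ker (L ^ k)) := by
  have hle : LinearMap.ker (L ^ k) ≤ LinearMap.ker (L ^ (k + 1)) := by
    intro x hx
    simp only [LinearMap.mem_ker] at hx ⊢
    rw [pow_succ', Module.End.mul_apply, hx, map_zero]
  have h := Submodule.finrank_sup_add_finrank_inf_eq
    (LinearMap.range L ⊓ LinearMap.ker (L ^ (k + 1))) (LinearMap.ker (L ^ k))
  rw [inf_assoc, inf_eq_right.mpr hle] at h
  have h1 := L.finrank_range_inf_ker_pow k
  have h2 : _ = Module.finrank K (LinearMap.ker (L ^ (k + 2))) :=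
    L.finrank_range_inf_ker_pow (k + 1)
  omega

/-- No Jordan block has size `k + 1` iff `ker L ^ (k + 1) ⊆ ker L ^ k + range L`. -/
theorem Module.End.ker_pow_succ_le_iff {K V : Type*} [Field K] [AddCommGroup V]
    [Module K V] [FiniteDimensional K V] (L : Module.End K V) (k : ℕ) :
    LinearMap.ker (L ^ (k + 1)) ≤ LinearMap.ker (L ^ k) ⊔ LinearMap.range L ↔
      2 * Module.finrank K (LinearMap.ker (L ^ (k + 1))) =
        Module.finrank K (LinearMap.ker (L ^ (k + 2))) +
          Module.finrank K (LinearMap.ker (L ^ k)) := by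
  have hle : LinearMap.ker (L ^ k) ≤ LinearMap.ker (L ^ (k + 1)) := by
    intro x hx
    simp only [LinearMap.mem_ker] at hx ⊢
    rw [pow_succ', Module.End.mul_apply, hx, map_zero]
  have h := L.finrank_range_inf_ker_pow_sup k
  rw [sup_comm, ← sup_inf_assoc_of_le _ hle] at h
  rw [← inf_eq_right]
  constructor
  · intro he
    rw [he] at h
    omega
  · intro he
    exact Submodule.eq_of_le_of_finrank_eq inf_le_right (by omega)

theorem Multiset.two_mul_sum_map_min_succ (d : Multiset ℕ) (k : ℕ) :
    2 * (d.map fun n => min n (k + 1)).sum =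
      (d.map fun n => min n (k + 2)).sum + (d.map fun n => min n k).sum + d.count (k + 1) := by
  induction d using Multiset.induction_on with
  | empty => simp
  | cons a d ih =>
    simp only [Multiset.map_cons, Multiset.sum_cons, Multiset.count_cons]
    split_ifs <;> omega

theorem Int.exists_support_of_symmetric {h : ℤ → ℕ} {N B e : ℤ}
    (hs : ∀ j, h j = h (N - j)) (hB : ∀ j < B, h j = 0) (he : h e ≠ 0) :
    ∃ a b : ℤ, a ≤ b ∧ h a ≠ 0 ∧ h b ≠ 0 ∧ (∀ j, j < a ∨ b < j → h j = 0) ∧ a + b = N := by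
  obtain ⟨a, ha, hmin⟩ := Int.exists_least_of_bdd (P := fun j => h j ≠ 0)
    ⟨B, fun j hj => not_lt.mp fun hlt => hj (hB j hlt)⟩ ⟨e, he⟩
  have hb : h (N - a) ≠ 0 := by rwa [← hs]
  refine ⟨a, N - a, hmin _ hb, ha, hb, ?_, by ring⟩
  rintro j (hj | hj)
  · by_contra hne
    exact absurd (hmin j hne) (by omega)
  · by_contra hne
    rw [hs] at hne
    exact absurd (hmin _ hne) (by omega)

theorem TruncPoly.exists_basis (K : Type) [Field K] (m : ℕ) :
    ∃ b : Module.Basis (Fin m) K (TruncPoly K m), ∀ j, b j = tbar K m ^ (j : ℕ) := by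
  let P := AdjoinRoot.powerBasis' (Polynomial.monic_X_pow (R := K) m)
  have hdim : P.dim = m := by
    simp [P, AdjoinRoot.powerBasis'_dim]
  have hP : ∀ j, P.basis.reindex (finCongr hdim) j = P.gen ^ (j : ℕ) := fun j => by
    rw [Module.Basis.reindex_apply, PowerBasis.basis_eq_pow]
    rfl
  exact ⟨P.basis.reindex (finCongr hdim), hP⟩

theorem hilb_tensorGrading_truncGrading (K : Type) [Field K] {V : Type} [AddCommGroup V]
    [Module K V] [FiniteDimensional K V] (ℳ : ℤ → Submodule K V) (m : ℕ) (k : ℤ) :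
    hilb K (tensorGrading K ℳ (truncGrading K m)) k =
      ∑ j : Fin m, hilb K ℳ (k - (j : ℕ)) := by
  classical
  obtain ⟨b, hb⟩ := TruncPoly.exists_basis K m
  let ι : (∀ j : Fin m, ℳ (k - (j : ℕ))) →ₗ[K] (Fin m →₀ V) :=
    (Finsupp.linearEquivFunOnFinite K V (Fin m)).symm.toLinearMap ∘ₗ
      LinearMap.pi fun j => (ℳ (k - (j : ℕ))).subtype ∘ₗ LinearMap.proj j
  let Φ := (TensorProduct.equivFinsuppOfBasisRight (M := V) b).symm.toLinearMap ∘ₗ ι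
  have hΦ : ∀ v, Φ v = ∑ j, (v j : V) ⊗ₜ[K] (tbar K m ^ (j : ℕ)) := by
    intro v
    change (TensorProduct.equivFinsuppOfBasisRight (M := V) b).symm (ι v) = _
    rw [TensorProduct.equivFinsuppOfBasisRight_symm_apply, Finsupp.sum_fintype _ _ (by simp)]
    exact Finset.sum_congr rfl fun j _ => by rw [hb]; rfl
  have hinj : Function.Injective Φ := by
    refine (TensorProduct.equivFinsuppOfBasisRight (M := V) b).symm.injective.comp ?_
    refine (Finsupp.linearEquivFunOnFinite K V (Fin m)).symm.injective.comp ?_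
    intro v w h
    ext j
    exact congrFun h j
  have hrange : LinearMap.range Φ = tensorGrading K ℳ (truncGrading K m) k := by
    apply le_antisymm
    · rintro _ ⟨v, rfl⟩
      rw [hΦ]
      refine Submodule.sum_mem _ fun j _ => ?_
      refine Submodule.mem_iSup_of_mem (k - (j : ℕ)) ?_
      have hj : tbar K m ^ (j : ℕ) ∈ truncGrading K m (k - (k - (j : ℕ))) := by
        rw [sub_sub_cancel, truncGrading, if_pos ⟨by omega, by omega⟩]
        exact Submodule.mem_span_singleton_self _
      exact ⟨v j ⊗ₜ ⟨_, hj⟩, rfl⟩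
    · refine iSup_le fun i => ?_
      rintro _ ⟨x, rfl⟩
      induction x using TensorProduct.induction_on with
      | zero => rw [map_zero]; exact zero_mem _
      | add x y hx hy => rw [map_add]; exact add_mem hx hy
      | tmul v w =>
        obtain ⟨w, hw⟩ := w
        rw [TensorProduct.map_tmul]
        change (v : V) ⊗ₜ[K] w ∈ _
        rw [truncGrading] at hw
        split_ifs at hw with hi
        · obtain ⟨a, rfl⟩ := Submodule.mem_span_singleton.mp hw
          rw [TensorProduct.tmul_smul]
          refine Submodule.smul_mem _ _ ?_
          obtain ⟨j, hj⟩ : ∃ j : ℕ, k - i = j := ⟨(k - i).toNat, by omega⟩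
          obtain rfl : i = k - j := by omega
          have hjm : j < m := by omega
          refine ⟨Pi.single ⟨j, hjm⟩ v, ?_⟩
          rw [hΦ, Finset.sum_eq_single ⟨j, hjm⟩]
          · simp
          · intro l _ hl
            rw [Pi.single_eq_of_ne hl]
            simp
          · simp
        · rw [(Submodule.mem_bot K).mp hw, TensorProduct.tmul_zero]
          exact zero_mem _
  rw [hilb, ← hrange, LinearMap.finrank_range_of_inj hinj, Module.finrank_pi_fintype]
  rfl

theorem gradedBetween_symHilb_of_symmetric (K : Type) [Field K] {V : Type} [AddCommGroup V]
    [Module K V] [FiniteDimensional K V] {ℳ : ℤ → Submodule K V} {N B e : ℤ}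
    (hs : ∀ j, hilb K ℳ j = hilb K ℳ (N - j)) (hB : ∀ j < B, hilb K ℳ j = 0)
    (he : hilb K ℳ e ≠ 0) : SymAround K ℳ N := by
  have hbot : ∀ j, hilb K ℳ j = 0 ↔ ℳ j = ⊥ := fun j => Submodule.finrank_eq_zero
  obtain ⟨a, b, hab, ha, hb, hout, hN⟩ := Int.exists_support_of_symmetric hs hB he
  refine ⟨a, b, ⟨hab, mt (hbot a).mpr ha, mt (hbot b).mpr hb, fun j hj => (hbot j).mp (hout j hj)⟩,
    hN, fun j => ?_⟩
  rw [hs, ← hN]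
  congr 1
  ring

theorem symHilbSome_of_symAround (K : Type) [Field K] {V : Type} [AddCommGroup V]
    [Module K V] {ℳ : ℤ → Submodule K V} {N : ℤ} (h : SymAround K ℳ N) : SymHilbSome K ℳ := by
  obtain ⟨a, b, hab, -, hs⟩ := h
  exact ⟨a, b, hab, hs⟩

/-- Tensoring with `K[t]/(t^m)` moves the reflecting degree by `(m - 1)/2`. -/
theorem symAround_tensorGrading_truncGrading (K : Type) [Field K] {V : Type} [AddCommGroup V]
    [Module K V] [FiniteDimensional K V] {ℳ : ℤ → Submodule K V} {N : ℤ}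
    (h : SymAround K ℳ N) (n : ℕ) :
    SymAround K (tensorGrading K ℳ (truncGrading K (n + 1))) (N + n) := by
  obtain ⟨a, b, ⟨-, ha, -, hout⟩, rfl, hs⟩ := h
  have hs' : ∀ j, hilb K ℳ j = hilb K ℳ (a + b - j) := fun j => by
    have := hs (j - a)
    rwa [add_sub_cancel, show b - (j - a) = a + b - j by ring] at this
  have hzero : ∀ j < a, hilb K ℳ j = 0 := fun j hj =>
    Submodule.finrank_eq_zero.mpr (hout j (.inl hj))
  obtain ⟨B, hB⟩ := TruncPoly.exists_basis K (n + 1)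
  have : FiniteDimensional K (TruncPoly K (n + 1)) := Module.Finite.of_basis B
  refine gradedBetween_symHilb_of_symmetric K (B := a) (e := a) (fun j => ?_) (fun j hj => ?_) ?_
  · rw [hilb_tensorGrading_truncGrading, hilb_tensorGrading_truncGrading,
      ← Equiv.sum_comp Fin.revPerm]
    refine Finset.sum_congr rfl fun l _ => ?_
    rw [hs']
    congr 1
    have := l.is_lt
    rw [Fin.revPerm_apply, Fin.val_rev]
    omega
  · rw [hilb_tensorGrading_truncGrading]
    exact Finset.sum_eq_zero fun l _ => hzero _ (by omega)
  · rw [hilb_tensorGrading_truncGrading]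
    refine fun h0 => ha ?_
    have := (Finset.sum_eq_zero_iff.mp h0) 0 (Finset.mem_univ _)
    rw [Fin.val_zero, Nat.cast_zero, sub_zero] at this
    exact Submodule.finrank_eq_zero.mp this

theorem mem_colonPlus_iff_s9 {K A : Type} [Field K] [CommRing A] [Algebra K A] {z x : A} {m : ℕ} :
    x ∈ colonPlus K z m ↔ ∃ k w : A, z ^ m * k = 0 ∧ x = k + z * w := by
  rw [colonPlus, Submodule.mem_sup]
  constructor
  · rintro ⟨k, hk, y, hy, rfl⟩
    obtain ⟨w, rfl⟩ := Ideal.mem_span_singleton'.mp hy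
    exact ⟨k, w, hk, by rw [mul_comm w]⟩
  · rintro ⟨k, w, hk, rfl⟩
    exact ⟨k, hk, z * w, Ideal.mul_mem_right _ _ (Ideal.mem_span_singleton_self z), rfl⟩

theorem mem_colonPlus_of_pow_mul_eq_zero {K A : Type} [Field K] [CommRing A] [Algebra K A]
    {z x : A} {m : ℕ} (h : z ^ m * x = 0) : x ∈ colonPlus K z m :=
  mem_colonPlus_iff_s9.mpr ⟨x, 0, h, by simp⟩

theorem mul_mem_colonPlus {K A : Type} [Field K] [CommRing A] [Algebra K A]
    (z w : A) (m : ℕ) : z * w ∈ colonPlus K z m :=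
  mem_colonPlus_iff_s9.mpr ⟨0, w, by simp, by simp⟩

theorem mulMap_pow_apply_s9 {K A : Type} [Field K] [CommRing A] [Algebra K A] (z x : A) (k : ℕ) :
    (mulMap K A z ^ k) x = z ^ k * x := by
  induction k with
  | zero => simp
  | succ k ih =>
    rw [pow_succ', Module.End.mul_apply, ih, pow_succ', mul_assoc]
    rfl

theorem colonPlus_restrictScalars {K A : Type} [Field K] [CommRing A] [Algebra K A]
    (z : A) (k : ℕ) : (colonPlus K z k).restrictScalars K =
      LinearMap.ker (mulMap K A z ^ k) ⊔ LinearMap.range (mulMap K A z) := by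
  ext x
  rw [Submodule.restrictScalars_mem, mem_colonPlus_iff_s9, Submodule.mem_sup]
  constructor
  · rintro ⟨k, w, hk, rfl⟩
    exact ⟨k, by rwa [LinearMap.mem_ker, mulMap_pow_apply_s9], z * w, ⟨w, rfl⟩, rfl⟩
  · rintro ⟨k, hk, _, ⟨w, rfl⟩, rfl⟩
    exact ⟨k, w, by rwa [LinearMap.mem_ker, mulMap_pow_apply_s9] at hk, rfl⟩

theorem colonPlus_mono {K A : Type} [Field K] [CommRing A] [Algebra K A]
    (z : A) : Monotone (colonPlus K z) := by
  refine monotone_nat_of_le_succ fun k x hx => ?_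
  obtain ⟨y, w, hy, rfl⟩ := mem_colonPlus_iff_s9.mp hx
  exact mem_colonPlus_iff_s9.mpr ⟨y, w, by rw [pow_succ', mul_assoc, hy, mul_zero], rfl⟩

/-- `k + 1` is not a Jordan block size iff `(0 : z ^ (k + 1)) + zA = (0 : z ^ k) + zA`. -/
theorem colonPlus_succ_le_iff {K A : Type} [Field K] [CommRing A] [Algebra K A]
    [FiniteDimensional K A] {z : A} {d : Multiset ℕ} (hd : IsJordanType K (mulMap K A z) d)
    (k : ℕ) : colonPlus K z (k + 1) ≤ colonPlus K z k ↔ k + 1 ∉ d := by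
  rw [← Submodule.restrictScalars_le K, colonPlus_restrictScalars, colonPlus_restrictScalars,
    sup_le_iff, and_iff_left le_sup_right, Module.End.ker_pow_succ_le_iff, hd.2, hd.2, hd.2,
    Multiset.two_mul_sum_map_min_succ, ← Multiset.count_eq_zero]
  omega

theorem colonPlus_eq_of_forall_notMem {K A : Type} [Field K] [CommRing A] [Algebra K A]
    [FiniteDimensional K A] {z : A} {d : Multiset ℕ} (hd : IsJordanType K (mulMap K A z) d)
    {k l : ℕ} (hkl : k ≤ l) (h : ∀ n, k < n → n ≤ l → n ∉ d) :
    colonPlus K z l = colonPlus K z k := by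
  induction l, hkl using Nat.le_induction with
  | base => rfl
  | succ l hkl ih =>
    rw [← ih fun n h1 h2 => h n h1 (h2.trans l.le_succ)]
    exact le_antisymm ((colonPlus_succ_le_iff hd l).mpr (h _ (by omega) le_rfl))
      (colonPlus_mono z l.le_succ)

theorem pow_mem_graded {K A : Type} [Field K] [CommRing A] [Algebra K A]
    (𝒜 : ℕ → Submodule K A) [GradedAlgebra 𝒜] {z : A} (hz : z ∈ 𝒜 1) (m : ℕ) : z ^ m ∈ 𝒜 m := by
  simpa using SetLike.pow_mem_graded m hz

/-- The top-degree functional of a graded Artinian Gorenstein algebra. -/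
theorem IsGorenstein.exists_functional {K A : Type} [Field K] [CommRing A] [Algebra K A]
    [FiniteDimensional K A] (𝒜 : ℕ → Submodule K A) [GradedAlgebra 𝒜] {c : ℕ}
    (htop : GradedTop K 𝒜 c) (hGor : IsGorenstein K 𝒜) :
    ∃ φ : A →ₗ[K] K, (∀ j, j ≠ c → ∀ a ∈ 𝒜 j, φ a = 0) ∧
      ∀ a, a ≠ 0 → ∃ b, φ (a * b) ≠ 0 := by
  obtain ⟨x, hx0, -, hx⟩ := hGor
  have hxc : x ∈ 𝒜 c := by
    obtain ⟨u, hu, hu0⟩ := Submodule.exists_mem_ne_zero_of_ne_bot htop.1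
    obtain ⟨k, rfl⟩ := hx u fun i hi y hy => by
      have := SetLike.mul_mem_graded hu hy
      rwa [htop.2 (c + i) (by omega), Submodule.mem_bot] at this
    exact (Submodule.smul_mem_iff _ (left_ne_zero_of_smul hu0)).mp hu
  obtain ⟨ψ, hψ⟩ : ∃ ψ : Module.Dual K A, ψ x ≠ 0 := by
    by_contra! h
    exact hx0 ((Module.forall_dual_apply_eq_zero_iff K x).mp h)
  refine ⟨ψ ∘ₗ GradedAlgebra.proj 𝒜 c, fun j hj a ha => ?_, fun a ha => ?_⟩
  · rw [LinearMap.comp_apply, GradedAlgebra.proj_apply, DirectSum.decompose_of_mem_ne 𝒜 ha hj,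
      map_zero]
  · have : IsArtinianRing A := IsArtinianRing.of_finite K A
    obtain ⟨_, ⟨b, hb, rfl⟩, hmin⟩ := IsArtinian.set_has_minimal
      {I : Ideal A | ∃ b, a * b ≠ 0 ∧ I = Ideal.span {a * b}} ⟨_, 1, by simpa using ha, rfl⟩
    obtain ⟨k, hk⟩ := hx (a * b) fun i hi y hy => by
      by_contra hne
      rw [mul_assoc] at hne
      have hle : Ideal.span {a * (b * y)} ≤ Ideal.span {a * b} := by
        rw [Ideal.span_singleton_le_span_singleton, ← mul_assoc]
        exact dvd_mul_right _ _
      have heq := hle.eq_of_not_lt (hmin _ ⟨_, hne, rfl⟩)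
      obtain ⟨t, ht⟩ := Ideal.span_singleton_le_span_singleton.mp heq.ge
      have hnil : IsNilpotent (y * t) := by
        refine (Commute.all y t).isNilpotent_mul_right ⟨c + 1, ?_⟩
        have := SetLike.pow_mem_graded (c + 1) hy
        rwa [htop.2 _ (by rw [smul_eq_mul]; nlinarith), Submodule.mem_bot] at this
      refine hb ((hnil.isUnit_one_sub.mul_left_eq_zero).mp ?_)
      linear_combination ht
    refine ⟨b, ?_⟩
    rw [hk, LinearMap.comp_apply, GradedAlgebra.proj_apply,
      DirectSum.decompose_of_mem_same 𝒜 (Submodule.smul_mem _ _ hxc), map_smul, smul_eq_mul]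
    refine mul_ne_zero ?_ hψ
    rintro rfl
    exact hb (by rw [hk, zero_smul])

/-- For a perfect pairing `(x, y) ↦ φ (x * y)`, the orthogonal of `0 : g` is `gA`. -/
theorem exists_eq_mul_of_functional_annihilates {K A : Type} [Field K] [CommRing A] [Algebra K A]
    [FiniteDimensional K A] {φ : A →ₗ[K] K} (hφ : ∀ a, a ≠ 0 → ∃ b, φ (a * b) ≠ 0) {g w : A}
    (h : ∀ y, g * y = 0 → φ (w * y) = 0) : ∃ v, w = g * v := by
  let T : A →ₗ[K] Module.Dual K A := (LinearMap.mul K A).compr₂ φ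
  have hT : Function.Injective T := by
    refine (injective_iff_map_eq_zero T).mpr fun a ha => ?_
    by_contra hne
    obtain ⟨b, hb⟩ := hφ a hne
    exact hb (LinearMap.congr_fun ha b)
  have hTs : Function.Surjective T :=
    (LinearMap.injective_iff_surjective_of_finrank_eq_finrank Subspace.dual_finrank_eq.symm).mp hT
  have hmem : T w ∈ LinearMap.range (LinearMap.mulLeft K g).dualMap := by
    rw [LinearMap.range_dualMap_eq_dualAnnihilator_ker, Submodule.mem_dualAnnihilator]
    exact fun y hy => h y hy
  obtain ⟨ψ, hψ⟩ := hmem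
  obtain ⟨v, rfl⟩ := hTs ψ
  refine ⟨v, hT ?_⟩
  rw [← hψ]
  ext y
  change φ (v * (g * y)) = φ (g * v * y)
  congr 1
  ring

theorem LinearMap.finrank_range_add_finrank_le_of_annihilates {K V W : Type*} [Field K]
    [AddCommGroup V] [Module K V] [AddCommGroup W] [Module K W] [FiniteDimensional K W]
    (β : V →ₗ[K] Module.Dual K W) (R : Submodule K W) (h : ∀ x, ∀ y ∈ R, β x y = 0) :
    Module.finrank K (LinearMap.range β) + Module.finrank K R ≤ Module.finrank K W := by
  have hle : LinearMap.range β ≤ R.dualAnnihilator := by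
    rintro _ ⟨x, rfl⟩
    exact (Submodule.mem_dualAnnihilator _).mpr (h x)
  have := Submodule.finrank_mono hle
  have := Subspace.finrank_add_finrank_dualAnnihilator_eq R
  omega

/-- The degree-`d` part of the ideal `0 : z ^ m`. -/
abbrev colonPiece (K : Type) [Field K] {A : Type} [CommRing A] [Algebra K A]
    (𝒜 : ℕ → Submodule K A) (z : A) (m d : ℕ) : Submodule K A :=
  LinearMap.ker (LinearMap.mulLeft K (z ^ m)) ⊓ 𝒜 d

/-- The map from the degree-`d` part of `0 : z ^ m` to the central simple module. -/
noncomputable def csProj (K : Type) [Field K] {A : Type} [CommRing A] [Algebra K A]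
    (𝒜 : ℕ → Submodule K A) (z : A) (m m' d : ℕ) :
    colonPiece K 𝒜 z m d →ₗ[K] CSMod K z m m' :=
  ((Submodule.comap (colonPlus K z m).subtype (colonPlus K z m')).mkQ.restrictScalars K) ∘ₗ
    LinearMap.codRestrict ((colonPlus K z m).restrictScalars K)
      (colonPiece K 𝒜 z m d).subtype
      fun x => mem_colonPlus_of_pow_mul_eq_zero (K := K) x.2.1

theorem mem_ker_csProj_iff {K A : Type} [Field K] [CommRing A] [Algebra K A]
    {𝒜 : ℕ → Submodule K A} {z : A} {m m' d : ℕ}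
    {x : colonPiece K 𝒜 z m d} :
    x ∈ LinearMap.ker (csProj K 𝒜 z m m' d) ↔ (x : A) ∈ colonPlus K z m' := by
  rw [LinearMap.mem_ker]
  exact Submodule.Quotient.mk_eq_zero
    (Submodule.comap (colonPlus K z m).subtype (colonPlus K z m'))

theorem pow_mul_decompose_eq_zero {K A : Type} [Field K] [CommRing A] [Algebra K A]
    (𝒜 : ℕ → Submodule K A) [GradedAlgebra 𝒜] {z : A} (hz : z ∈ 𝒜 1) {m : ℕ} {x : A}
    (hx : z ^ m * x = 0) (j : ℕ) : z ^ m * (DirectSum.decompose 𝒜 x j : A) = 0 := by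
  rw [← DirectSum.coe_decompose_mul_add_of_left_mem 𝒜 (pow_mem_graded 𝒜 hz m), hx,
    DirectSum.decompose_zero]
  rfl

theorem range_csProj {K A : Type} [Field K] [CommRing A] [Algebra K A]
    (𝒜 : ℕ → Submodule K A) [GradedAlgebra 𝒜] {z : A} (hz : z ∈ 𝒜 1) (m m' d : ℕ) :
    LinearMap.range (csProj K 𝒜 z m m' d) = csGrading K 𝒜 z m m' d := by
  apply le_antisymm
  · rintro _ ⟨x, rfl⟩
    exact ⟨⟨x, mem_colonPlus_of_pow_mul_eq_zero x.2.1⟩, x.2.2, rfl⟩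
  · rintro _ ⟨⟨u, hu⟩, hud, rfl⟩
    obtain ⟨k, w, hk, rfl⟩ := mem_colonPlus_iff_s9.mp hu
    refine ⟨⟨DirectSum.decompose 𝒜 k d, pow_mul_decompose_eq_zero 𝒜 hz hk d,
      SetLike.coe_mem _⟩, ?_⟩
    refine (Submodule.Quotient.eq
      (Submodule.comap (colonPlus K z m).subtype (colonPlus K z m'))).mpr ?_
    change (DirectSum.decompose 𝒜 k d : A) - (k + z * w) ∈ colonPlus K z m'
    have hdec : (k + z * w : A) =
        DirectSum.decompose 𝒜 k d + (DirectSum.decompose 𝒜 (z * w) d : A) := by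
      have h1 : (DirectSum.decompose 𝒜 (k + z * w) d : A) = k + z * w :=
        DirectSum.decompose_of_mem_same 𝒜 hud
      rw [← h1, DirectSum.decompose_add]
      rfl
    rw [hdec, sub_add_cancel_left]
    refine neg_mem ?_
    rcases d with _ | d
    · rw [DirectSum.coe_decompose_mul_of_left_mem_of_not_le 𝒜 hz (by omega)]
      exact zero_mem _
    · rw [add_comm d 1, DirectSum.coe_decompose_mul_add_of_left_mem 𝒜 hz]
      exact mul_mem_colonPlus _ _ _

theorem finrank_csGrading_add_finrank_ker {K A : Type} [Field K] [CommRing A] [Algebra K A]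
    [FiniteDimensional K A] (𝒜 : ℕ → Submodule K A) [GradedAlgebra 𝒜] {z : A} (hz : z ∈ 𝒜 1)
    (m m' d : ℕ) : Module.finrank K (csGrading K 𝒜 z m m' d) +
      Module.finrank K (LinearMap.ker (csProj K 𝒜 z m m' d)) =
        Module.finrank K (colonPiece K 𝒜 z m d) := by
  rw [← range_csProj 𝒜 hz]
  exact LinearMap.finrank_range_add_finrank_ker _

/-- The pairing `(x, y) ↦ φ (z ^ n * x * y)` embeds the degree-`d` piece of a central simple
module into the dual of its complementary piece. -/
theorem finrank_csGrading_le {K A : Type} [Field K] [CommRing A] [Algebra K A]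
    [FiniteDimensional K A] (𝒜 : ℕ → Submodule K A) [GradedAlgebra 𝒜] {c : ℕ}
    {φ : A →ₗ[K] K} (hφc : ∀ j, j ≠ c → ∀ a ∈ 𝒜 j, φ a = 0)
    (hφ : ∀ a, a ≠ 0 → ∃ b, φ (a * b) ≠ 0) {z : A} (hz : z ∈ 𝒜 1) {n m' : ℕ}
    (hC : colonPlus K z n = colonPlus K z m') {d e : ℕ} (hde : n + d + e = c) :
    Module.finrank K (csGrading K 𝒜 z (n + 1) m' d) ≤
      Module.finrank K (csGrading K 𝒜 z (n + 1) m' e) := by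
  let β : colonPiece K 𝒜 z (n + 1) d →ₗ[K] Module.Dual K (colonPiece K 𝒜 z (n + 1) e) :=
    ((LinearMap.mul K A).compr₂ φ ∘ₗ LinearMap.mulLeft K (z ^ n)).domRestrict₁₂ _ _
  have hβ : ∀ x y, β x y = φ (z ^ n * x * y) := fun _ _ => rfl
  have hker : LinearMap.ker β ≤ LinearMap.ker (csProj K 𝒜 z (n + 1) m' d) := by
    intro x hx
    rw [mem_ker_csProj_iff, ← hC, mem_colonPlus_iff_s9]
    obtain ⟨v, hv⟩ : ∃ v, z ^ n * (x : A) = z ^ (n + 1) * v := by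
      refine exists_eq_mul_of_functional_annihilates hφ fun y hy => ?_
      classical
      rw [← DirectSum.sum_support_decompose 𝒜 y, Finset.mul_sum, map_sum]
      refine Finset.sum_eq_zero fun j _ => ?_
      by_cases hj : j = e
      · subst hj
        exact LinearMap.congr_fun hx
          ⟨DirectSum.decompose 𝒜 y j, pow_mul_decompose_eq_zero 𝒜 hz hy j, SetLike.coe_mem _⟩
      · refine hφc (n + d + j) (by omega) _ ?_
        exact SetLike.mul_mem_graded (SetLike.mul_mem_graded (pow_mem_graded 𝒜 hz n) x.2.2)
          (SetLike.coe_mem _)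
    exact ⟨x - z * v, v, by linear_combination hv, by ring⟩
  have hR := LinearMap.finrank_range_add_finrank_le_of_annihilates β
    (LinearMap.ker (csProj K 𝒜 z (n + 1) m' e)) fun x y hy => by
      rw [mem_ker_csProj_iff, ← hC, mem_colonPlus_iff_s9] at hy
      obtain ⟨k, w, hk, hy⟩ := hy
      have hx : z ^ (n + 1) * (x : A) = 0 := x.2.1
      rw [hβ, hy]
      convert map_zero φ using 2
      linear_combination (x : A) * hk + w * hx
  have h1 := LinearMap.finrank_range_add_finrank_ker β
  have h2 := finrank_csGrading_add_finrank_ker 𝒜 hz (n + 1) m' d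
  have h3 := finrank_csGrading_add_finrank_ker 𝒜 hz (n + 1) m' e
  have h4 := Submodule.finrank_mono hker
  omega

theorem csGrading_eq_bot_of_lt {K A : Type} [Field K] [CommRing A] [Algebra K A]
    (𝒜 : ℕ → Submodule K A) [GradedAlgebra 𝒜] {c : ℕ} (htop : GradedTop K 𝒜 c) {z : A}
    (hz : z ∈ 𝒜 1) {n m' : ℕ} (hC : colonPlus K z n = colonPlus K z m') {d : ℕ}
    (hd : c < n + d) : csGrading K 𝒜 z (n + 1) m' d = ⊥ := by
  rw [← range_csProj 𝒜 hz, LinearMap.range_eq_bot]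
  ext x
  refine mem_ker_csProj_iff.mpr (hC ▸ mem_colonPlus_of_pow_mul_eq_zero ?_)
  have := SetLike.mul_mem_graded (pow_mem_graded 𝒜 hz n) x.2.2
  rwa [htop.2 _ hd, Submodule.mem_bot] at this

theorem exists_csGrading_ne_bot {K A : Type} [Field K] [CommRing A] [Algebra K A]
    (𝒜 : ℕ → Submodule K A) [GradedAlgebra 𝒜] {z : A} (hz : z ∈ 𝒜 1) {m m' : ℕ}
    (h : ¬ colonPlus K z m ≤ colonPlus K z m') : ∃ d, csGrading K 𝒜 z m m' d ≠ ⊥ := by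
  by_contra! hbot
  refine h fun u hu => ?_
  obtain ⟨k, w, hk, rfl⟩ := mem_colonPlus_iff_s9.mp hu
  refine add_mem ?_ (mul_mem_colonPlus _ _ _)
  classical
  rw [← DirectSum.sum_support_decompose 𝒜 k]
  refine Submodule.sum_mem _ fun j _ => ?_
  have hx : (⟨DirectSum.decompose 𝒜 k j, pow_mul_decompose_eq_zero 𝒜 hz hk j,
      SetLike.coe_mem _⟩ : colonPiece K 𝒜 z m j) ∈
      LinearMap.ker (csProj K 𝒜 z m m' j) := by
    have := hbot j
    rw [← range_csProj 𝒜 hz, LinearMap.range_eq_bot] at this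
    rw [this]
    trivial
  exact mem_ker_csProj_iff.mp hx

theorem symAround_natToZ_csGrading {K A : Type} [Field K] [CommRing A] [Algebra K A]
    [FiniteDimensional K A] (𝒜 : ℕ → Submodule K A) [GradedAlgebra 𝒜] {c : ℕ}
    (htop : GradedTop K 𝒜 c) (hGor : IsGorenstein K 𝒜) {z : A} (hz : z ∈ 𝒜 1) {n m' : ℕ}
    (hC : colonPlus K z n = colonPlus K z m') (hlt : ¬ colonPlus K z (n + 1) ≤ colonPlus K z n) :
    SymAround K (natToZ K (csGrading K 𝒜 z (n + 1) m')) (c - n) := by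
  obtain ⟨φ, hφc, hφ⟩ := hGor.exists_functional 𝒜 htop
  have hneg : ∀ j < 0, hilb K (natToZ K (csGrading K 𝒜 z (n + 1) m')) j = 0 := fun j hj => by
    rw [hilb, natToZ, if_neg (by omega), finrank_bot]
  have hle : ∀ j, hilb K (natToZ K (csGrading K 𝒜 z (n + 1) m')) j ≤
      hilb K (natToZ K (csGrading K 𝒜 z (n + 1) m')) (c - n - j) := by
    intro j
    rcases lt_or_ge j 0 with hj | hj
    · rw [hneg j hj]
      exact Nat.zero_le _
    rcases le_or_gt j (c - n) with hj' | hj'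
    · rw [hilb, hilb, natToZ, natToZ, if_pos hj, if_pos (by omega)]
      exact finrank_csGrading_le 𝒜 hφc hφ hz hC (by omega)
    · rw [hilb, natToZ, if_pos hj, csGrading_eq_bot_of_lt 𝒜 htop hz hC (by omega), finrank_bot]
      exact Nat.zero_le _
  obtain ⟨e, he⟩ := exists_csGrading_ne_bot 𝒜 hz (hC ▸ hlt)
  refine gradedBetween_symHilb_of_symmetric K (B := 0) (e := e) (fun j => ?_) hneg ?_
  · refine (hle j).antisymm ((hle _).trans_eq ?_)
    rw [sub_sub_cancel]
  · rw [hilb, natToZ, if_pos (by omega), Int.toNat_natCast]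
    exact mt Submodule.finrank_eq_zero.mp he

theorem DistinctSizes.notMem_of_nextSize_lt {d : Multiset ℕ} {s : ℕ} {f : Fin s → ℕ}
    (hf : DistinctSizes d f) (i : Fin s) {n : ℕ} (h1 : nextSize f i < n) (h2 : n < f i) :
    n ∉ d := by
  rw [← hf.2]
  rintro ⟨j, rfl⟩
  have hij : i < j := hf.1.lt_iff_gt.mp h2
  have hlt : (i : ℕ) + 1 < s := by omega
  rw [nextSize, dif_pos hlt] at h1
  have : j < ⟨(i : ℕ) + 1, hlt⟩ := hf.1.lt_iff_gt.mp h1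
  rw [Fin.lt_def] at this hij
  simp only at this
  omega

theorem DistinctSizes.nextSize_lt {d : Multiset ℕ} {s : ℕ} {f : Fin s → ℕ}
    (hf : DistinctSizes d f) (hpos : ∀ n ∈ d, 0 < n) (i : Fin s) : nextSize f i < f i := by
  rw [nextSize]
  split_ifs with h
  · exact hf.1 (Fin.lt_def.mpr (Nat.lt_succ_self _))
  · exact hpos _ ((hf.2 _).mp ⟨i, rfl⟩)


/-- Proposition 5.3. Let `K` be any field, `A = ⊕_{i=0}^{c} A_i`
a graded Artinian Gorenstein `K`-algebra and `z ∈ A₁` a linear form.  Then every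
central simple module `U_i` of `(A, z)` has a symmetric Hilbert function, and
`Ũ_i = U_i ⊗_K K[t]/(t^{f_i})` has a symmetric Hilbert function with reflecting
degree `c/2` (the reflecting degree of the Hilbert function of `A`). -/
theorem statement_9 {K A : Type} [Field K] [CommRing A] [Algebra K A]
    (𝒜 : ℕ → Submodule K A) (c : ℕ)
    (hA : IsGradedArtinAlg K 𝒜) (htop : GradedTop K 𝒜 c)
    (hGor : IsGorenstein K 𝒜)
    (z : A) (hz : z ∈ 𝒜 1)
    (d : Multiset ℕ) (hd : IsJordanType K (mulMap K A z) d)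
    (s : ℕ) (f : Fin s → ℕ) (hf : DistinctSizes d f) :
    ∀ i : Fin s,
      SymHilbSome K (natToZ K (csGrading K 𝒜 z (f i) (nextSize f i))) ∧
      SymAround K
        (tensorGrading K (natToZ K (csGrading K 𝒜 z (f i) (nextSize f i)))
          (truncGrading K (f i)))
        (c : ℤ) := by
  obtain ⟨hint, hone, hmul, -, hfin⟩ := hA
  let : DirectSum.Decomposition 𝒜 := hint.chooseDecomposition
  have : SetLike.GradedMonoid 𝒜 :=
    { one_mem := hone, mul_mem := fun _ _ _ _ hx hy => hmul _ _ _ hx _ hy }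
  let : GradedAlgebra 𝒜 := {}
  intro i
  have hnext := hf.nextSize_lt hd.1 i
  obtain ⟨n, hn⟩ : ∃ n, f i = n + 1 := ⟨f i - 1, by omega⟩
  have hC : colonPlus K z n = colonPlus K z (nextSize f i) :=
    colonPlus_eq_of_forall_notMem hd (by omega) fun k h1 h2 =>
      hf.notMem_of_nextSize_lt i h1 (by omega)
  have hlt : ¬ colonPlus K z (n + 1) ≤ colonPlus K z n := by
    rw [colonPlus_succ_le_iff hd, not_not, ← hn]
    exact (hf.2 _).mp ⟨i, rfl⟩
  have hsym := symAround_natToZ_csGrading 𝒜 htop hGor hz hC hlt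
  rw [hn]
  refine ⟨symHilbSome_of_symAround K hsym, ?_⟩
  have hten := symAround_tensorGrading_truncGrading K hsym n
  rwa [sub_add_cancel] at hten
end
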